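/- arXiv:2307.07962 — 2 statements merged into one kernel-verified Lean document; each statement's English description precedes it below -/
import Mathlib

section
/- Let k ≥ 2, and let n, t be integers with 1 ≤ t ≤ 2k−2 and n ≥ 78t²k. Let G be a C_{2k+1}-free graph on n vertices with e(G) ≥ ⌊(n−t−1)²/4⌋ + (t+2 choose 2). Then there exists T ⊆ V(G) with |T| ≤ 3(t+1) and a partition of V(G) \ T into sets X and Y such that G − T is bipartite with parts X and Y (i.e., no edge of G joins two vertices of X or two vertices of Y), and moreover: (i) every vertex of G − T has degree at least (n−3t−1)/3 in G − T; (ii) n/2 − 2√(tn) ≤ |X|, |Y| ≤ n/2 + √(3tn); (iii) the number of vertices u ∈ V(G) \ T whose degree in G − T is at most n/2 − √(3tn) is at most √(tn); (iv) for every v ∈ T, either all neighbors of v lying in X ∪ Y belong to X, or all of them belong to Y. -/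
/-- A graph `G` is `Cₘ`-free if it contains no subgraph isomorphic to the cycle of length `m`. -/
def CycleFree {V : Type*} (G : SimpleGraph V) (m : ℕ) : Prop :=
  ∀ f : SimpleGraph.cycleGraph m →g G, ¬ Function.Injective f

theorem CycleFree.false_of_seq {V : Type*} {G : SimpleGraph V} {m : ℕ} (hG : CycleFree G m)
    (hm : 2 ≤ m) (f : ℕ → V) (hinj : Set.InjOn f (Set.Iio m))
    (hadj : ∀ i, i + 1 < m → G.Adj (f i) (f (i + 1))) (hlast : G.Adj (f (m - 1)) (f 0)) :
    False := by
  obtain ⟨m, rfl⟩ : ∃ l, m = l + 2 := ⟨m - 2, by omega⟩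
  have key : ∀ a b : Fin (m + 2), a - b = 1 → G.Adj (f b) (f a) := by
    intro a b hab
    obtain rfl : a = b + 1 := by rw [← hab]; abel
    by_cases hb : (b : ℕ) + 1 < m + 2
    · rw [Fin.val_add_one_of_lt' (by omega)]
      exact hadj _ hb
    · obtain rfl : b = Fin.last (m + 1) := Fin.ext (by simp; omega)
      simpa using hlast
  refine hG ⟨fun i => f i, ?_⟩ ?_
  · intro a b hab
    rw [SimpleGraph.cycleGraph_adj] at hab
    rcases hab with h | h
    · exact (key a b h).symm
    · exact key b a h
  · intro a b hab
    exact Fin.ext (hinj a.2 b.2 hab)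

/-- The number of neighbours of `u` in `B`. -/
def degIn {V : Type*} (G : SimpleGraph V) [DecidableRel G.Adj] (u : V) (B : Finset V) : ℕ :=
  (B.filter fun w => G.Adj u w).card

/-- The number of ordered pairs of adjacent vertices in `A × B`. -/
def adjPairs {V : Type*} (G : SimpleGraph V) [DecidableRel G.Adj] (A B : Finset V) : ℕ :=
  ∑ u ∈ A, degIn G u B

section Counting

variable {V : Type*} (G : SimpleGraph V) [DecidableRel G.Adj]

theorem adjPairs_comm (A B : Finset V) : adjPairs G A B = adjPairs G B A := by
  simp only [adjPairs, degIn, Finset.card_filter]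
  rw [Finset.sum_comm]
  simp only [G.adj_comm]

theorem degIn_le_card (u : V) (B : Finset V) : degIn G u B ≤ B.card :=
  Finset.card_filter_le _ _

theorem adjPairs_singleton_left (v : V) (B : Finset V) : adjPairs G {v} B = degIn G v B := by
  simp [adjPairs]

theorem degIn_singleton_self (v : V) : degIn G v {v} = 0 := by
  simp [degIn]

theorem adjPairs_self_eq_zero {G : SimpleGraph V} [DecidableRel G.Adj] {A : Finset V}
    (h : ∀ x ∈ A, ∀ y ∈ A, ¬ G.Adj x y) :
    adjPairs G A A = 0 := by
  refine Finset.sum_eq_zero fun u hu => ?_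
  rw [degIn, Finset.card_eq_zero, Finset.filter_eq_empty_iff]
  exact fun w hw => h u hu w hw

theorem four_mul_edges_le_two_mul_adjPairs {G : SimpleGraph V} [DecidableRel G.Adj]
    [Fintype V] {n t : ℕ} (hnt : t + 1 ≤ n)
    (hedge : (n - t - 1) ^ 2 / 4 + (t + 2).choose 2 ≤ G.edgeFinset.card) :
    (n : ℤ) ^ 2 - 2 * (t + 1) * n + 3 * t ^ 2 + 8 * t + 4 ≤
      2 * adjPairs G Finset.univ Finset.univ := by
  have h1 : adjPairs G Finset.univ Finset.univ = 2 * G.edgeFinset.card := by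
    rw [← G.sum_degrees_eq_twice_card_edges]
    refine Finset.sum_congr rfl fun u _ => ?_
    rw [← G.card_neighborFinset_eq_degree, degIn]
    congr 1
    ext w
    simp
  have h2 : 2 * (t + 2).choose 2 = (t + 2) * (t + 1) := by
    rw [Nat.choose_two_right, Nat.mul_div_cancel']
    · rfl
    · exact (Nat.even_mul_pred_self _).two_dvd
  obtain ⟨m, rfl⟩ : ∃ m, n = m + t + 1 := ⟨n - t - 1, by omega⟩
  rw [show m + t + 1 - t - 1 = m by omega] at hedge
  have h3 : m ^ 2 ≤ 4 * (m ^ 2 / 4) + 1 := by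
    rcases Nat.even_or_odd' m with ⟨c, rfl | rfl⟩
    · rw [show (2 * c) ^ 2 = 4 * c ^ 2 by ring]
      omega
    · rw [show (2 * c + 1) ^ 2 = 4 * (c ^ 2 + c) + 1 by ring]
      omega
  rw [h1]
  have h4 : m ^ 2 + 2 * ((t + 2) * (t + 1)) ≤ 4 * G.edgeFinset.card + 1 := by omega
  zify at h4
  push_cast
  nlinarith

theorem adjPairs_singleton_right (v : V) (B : Finset V) : adjPairs G B {v} = degIn G v B := by
  rw [adjPairs_comm, adjPairs_singleton_left]

theorem adjPairs_le_mul (A B : Finset V) : adjPairs G A B ≤ A.card * B.card := by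
  rw [← smul_eq_mul]
  exact Finset.sum_le_card_nsmul _ _ _ fun u _ => degIn_le_card G u B

variable [DecidableEq V]

theorem degIn_union {A B : Finset V} (h : Disjoint A B) (u : V) :
    degIn G u (A ∪ B) = degIn G u A + degIn G u B := by
  simp only [degIn, Finset.filter_union]
  exact Finset.card_union_of_disjoint (Finset.disjoint_filter_filter h)

theorem adjPairs_union_left {A B : Finset V} (h : Disjoint A B) (C : Finset V) :
    adjPairs G (A ∪ B) C = adjPairs G A C + adjPairs G B C :=
  Finset.sum_union h

theorem adjPairs_union_right {A B : Finset V} (h : Disjoint A B) (C : Finset V) :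
    adjPairs G C (A ∪ B) = adjPairs G C A + adjPairs G C B := by
  rw [adjPairs_comm, adjPairs_union_left G h, adjPairs_comm G A, adjPairs_comm G B]

theorem adjPairs_union_self {A B : Finset V} (h : Disjoint A B) :
    adjPairs G (A ∪ B) (A ∪ B) = adjPairs G A A + 2 * adjPairs G A B + adjPairs G B B := by
  rw [adjPairs_union_left G h, adjPairs_union_right G h, adjPairs_union_right G h,
    adjPairs_comm G B A]
  ring

theorem degIn_erase_self (v : V) (S : Finset V) : degIn G v (S.erase v) = degIn G v S := by
  unfold degIn
  congr 1
  ext w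
  simp only [Finset.mem_filter, Finset.mem_erase]
  exact ⟨fun h => ⟨h.1.2, h.2⟩, fun h => ⟨⟨h.2.ne', h.1⟩, h.2⟩⟩

theorem adjPairs_erase {S : Finset V} {v : V} (hv : v ∈ S) :
    adjPairs G S S = adjPairs G (S.erase v) (S.erase v) + 2 * degIn G v S := by
  have hd : Disjoint (S.erase v) {v} := by simp
  have hS : S.erase v ∪ {v} = S := by
    rw [Finset.union_comm, ← Finset.insert_eq, Finset.insert_erase hv]
  conv_lhs => rw [← hS]
  rw [adjPairs_union_self G hd, adjPairs_singleton_right, adjPairs_singleton_left,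
    degIn_singleton_self, degIn_erase_self]
  ring

theorem adjPairs_le_of_degenerate (d : ℕ) (A : Finset V)
    (h : ∀ S ⊆ A, S.Nonempty → ∃ u ∈ S, degIn G u S ≤ d) :
    adjPairs G A A ≤ 2 * d * A.card := by
  induction hn : A.card generalizing A with
  | zero =>
    rw [Finset.card_eq_zero] at hn
    simp [hn, adjPairs]
  | succ m ih =>
    obtain ⟨u, hu, hd⟩ := h A subset_rfl (Finset.card_pos.1 (by omega))
    have := ih (A.erase u) (fun S hS => h S (hS.trans (Finset.erase_subset _ _)))
      (by rw [Finset.card_erase_of_mem hu]; omega)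
    rw [adjPairs_erase G hu]
    nlinarith

theorem exists_path_of_le_degIn {S : Finset V} (hS : S.Nonempty) {m : ℕ}
    (hdeg : ∀ u ∈ S, m ≤ degIn G u S) (j : ℕ) (hj : j ≤ m) :
    ∃ f : ℕ → V, Set.InjOn f (Set.Iio (j + 1)) ∧ (∀ i, f i ∈ S) ∧
      ∀ i < j, G.Adj (f i) (f (i + 1)) := by
  induction j with
  | zero =>
    obtain ⟨s, hs⟩ := hS
    refine ⟨fun _ => s, ?_, fun _ => hs, by simp⟩
    intro a ha b hb _
    simp at ha hb
    omega
  | succ j ih =>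
    obtain ⟨f, hinj, hmem, hadj⟩ := ih (by omega)
    obtain ⟨w, hw, hwf⟩ : ∃ w ∈ S.filter (fun w => G.Adj (f j) w),
        w ∉ (Finset.range j).image f := by
      apply Finset.exists_mem_notMem_of_card_lt_card
      have h1 := hdeg (f j) (hmem j)
      have h2 : ((Finset.range j).image f).card ≤ j := by
        simpa using Finset.card_image_le (s := Finset.range j) (f := f)
      unfold degIn at h1
      omega
    rw [Finset.mem_filter] at hw
    have hne : ∀ i, i < j + 1 → f i ≠ w := by
      intro i hi h
      rcases Nat.lt_succ_iff_lt_or_eq.1 hi with hi | rfl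
      · exact hwf (Finset.mem_image.2 ⟨i, Finset.mem_range.2 hi, h⟩)
      · exact hw.2.ne h
    refine ⟨fun i => if i < j + 1 then f i else w, ?_, ?_, ?_⟩
    · intro a ha b hb hab
      simp only [Set.mem_Iio] at ha hb
      dsimp only at hab
      split_ifs at hab with h1 h2 h2
      · exact hinj h1 h2 hab
      · exact absurd hab (hne a h1)
      · exact absurd hab.symm (hne b h2)
      · omega
    · intro i
      dsimp only
      split_ifs
      · exact hmem i
      · exact hw.1
    · intro i hi
      rcases Nat.lt_succ_iff_lt_or_eq.1 hi with hi | rfl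
      · simpa [show i < j + 1 by omega, hi] using hadj i hi
      · simpa using hw.2

variable {G}

/-- The neighbourhood of a vertex of a `C_{2k+1}`-free graph is sparse. -/
theorem CycleFree.adjPairs_neighbors_le {k : ℕ} (hk : 2 ≤ k) (hG : CycleFree G (2 * k + 1))
    (v : V) (A : Finset V) (hA : ∀ u ∈ A, G.Adj v u) :
    adjPairs G A A ≤ 2 * (2 * k - 2) * A.card := by
  apply adjPairs_le_of_degenerate
  intro S hSA hS
  by_contra! hdeg
  obtain ⟨f, hinj, hmem, hadj⟩ := exists_path_of_le_degIn G hS (m := 2 * k - 1)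
    (fun u hu => by have := hdeg u hu; omega) (2 * k - 1) le_rfl
  have hv : ∀ i, G.Adj v (f i) := fun i => hA _ (hSA (hmem i))
  refine hG.false_of_seq (by omega) (fun i => if i = 0 then v else f (i - 1)) ?_ ?_ ?_
  · intro a ha b hb hab
    simp only [Set.mem_Iio] at ha hb
    dsimp only at hab
    split_ifs at hab with h1 h2 h2
    · omega
    · exact absurd hab (hv _).ne
    · exact absurd hab (hv _).ne'
    · have := hinj (show a - 1 < _ by omega) (show b - 1 < _ by omega) hab
      omega
  · intro i hi
    rcases i with _ | i
    · simpa using hv 0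
    · simpa using hadj i (by omega)
  · simpa [show k ≠ 0 by omega] using (hv _).symm

/-- A path through prescribed vertices of `P` and common neighbours in `Q` closes up to an odd
cycle. -/
theorem CycleFree.false_of_common_neighbors {k : ℕ} (hk : 2 ≤ k) (hG : CycleFree G (2 * k + 1))
    {P Q : Finset V} (hPQ : Disjoint P Q) (hP : k ≤ P.card)
    (hcom : ∀ p ∈ P, ∀ q ∈ P, k + 1 ≤ (Q.filter fun w => G.Adj p w ∧ G.Adj q w).card)
    {x y p q : V} (hxy : G.Adj x y) (hx : x ∉ P) (hy : y ∉ P) (hp : p ∈ P) (hq : q ∈ P)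
    (hpq : p ≠ q) (hxp : G.Adj x p) (hyq : G.Adj y q) : False := by
  obtain ⟨e⟩ : Nonempty (Fin (k - 2) ↪ ((P.erase p).erase q : Finset V)) := by
    apply Function.Embedding.nonempty_of_card_le
    rw [Fintype.card_fin, Fintype.card_coe, Finset.card_erase_of_mem
      (Finset.mem_erase.2 ⟨hpq.symm, hq⟩), Finset.card_erase_of_mem hp]
    omega
  have he : ∀ i, (e i : V) ≠ q ∧ (e i : V) ≠ p ∧ (e i : V) ∈ P := fun i => by
    have := (e i).2
    rwa [Finset.mem_erase, Finset.mem_erase] at this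
  obtain ⟨β, hβ0, hβk, hβP, hβi⟩ : ∃ β : ℕ → V, β 0 = p ∧ β (k - 1) = q ∧ (∀ i, β i ∈ P) ∧
      Set.InjOn β (Set.Iio k) := by
    refine ⟨fun i => if i = 0 then p else if h : i - 1 < k - 2 then e ⟨i - 1, h⟩ else q,
      by simp, ?_, ?_, ?_⟩
    · simp [show k - 1 ≠ 0 by omega, show ¬ (k - 1 - 1 < k - 2) by omega]
    · intro i
      dsimp only
      split_ifs
      exacts [hp, (he _).2.2, hq]
    · intro a ha b hb hab
      simp only [Set.mem_Iio] at ha hb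
      dsimp only at hab
      split_ifs at hab with h1 h2 h3 h3 h4 h5 h5 h5
      · omega
      · exact absurd hab.symm (he _).2.1
      · exact absurd hab hpq
      · exact absurd hab (he _).2.1
      · have := e.injective (Subtype.ext hab)
        simp at this
        omega
      · exact absurd hab (he _).1
      · exact absurd hab.symm hpq
      · exact absurd hab.symm (he _).1
      · omega
  obtain ⟨c, hci, hc⟩ : ∃ c : Fin (k - 1) → V, Function.Injective c ∧ ∀ i : Fin (k - 1),
      c i ∈ (Q.filter fun w => G.Adj (β i) w ∧ G.Adj (β (i + 1)) w) \ {x, y} := by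
    rw [← Finset.all_card_le_biUnion_card_iff_exists_injective]
    intro s
    rcases s.eq_empty_or_nonempty with rfl | ⟨i, hi⟩
    · simp
    · have h1 := Finset.card_le_card (Finset.subset_biUnion_of_mem
        (fun i : Fin (k - 1) =>
          (Q.filter fun w => G.Adj (β i) w ∧ G.Adj (β (i + 1)) w) \ {x, y}) hi)
      have h2 := hcom _ (hβP i) _ (hβP (i + 1))
      have h3 := Finset.le_card_sdiff {x, y}
        (Q.filter fun w => G.Adj (β i) w ∧ G.Adj (β (i + 1)) w)
      have h4 := Finset.card_le_two (a := x) (b := y)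
      have h5 := Finset.card_le_univ s
      rw [Fintype.card_fin] at h5
      omega
  have hc' : ∀ i, c i ∈ Q ∧ G.Adj (β i) (c i) ∧ G.Adj (β (i + 1)) (c i) ∧ c i ≠ x ∧ c i ≠ y := by
    intro i
    have := hc i
    simp only [Finset.mem_sdiff, Finset.mem_filter, Finset.mem_insert, Finset.mem_singleton,
      not_or] at this
    tauto
  obtain ⟨α, hα0, hαk, hαP, hαi, hαl, hαr⟩ : ∃ α : ℕ → V, α 0 = x ∧ α k = y ∧
      (∀ i, α i ∉ P) ∧ Set.InjOn α (Set.Iio (k + 1)) ∧ (∀ i < k, G.Adj (α i) (β i)) ∧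
      ∀ i < k, G.Adj (β i) (α (i + 1)) := by
    refine ⟨fun i => if i = 0 then x else if h : i - 1 < k - 1 then c ⟨i - 1, h⟩ else y,
      by simp, ?_, ?_, ?_, ?_, ?_⟩
    · simp [show k ≠ 0 by omega]
    · intro i
      dsimp only
      split_ifs
      exacts [hx, fun h => Finset.disjoint_left.1 hPQ h (hc' _).1, hy]
    · intro a ha b hb hab
      simp only [Set.mem_Iio] at ha hb
      dsimp only at hab
      split_ifs at hab with h1 h2 h3 h3 h4 h5 h5 h5
      · omega
      · exact absurd hab.symm (hc' _).2.2.2.1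
      · exact absurd hab hxy.ne
      · exact absurd hab (hc' _).2.2.2.1
      · have := hci hab
        simp at this
        omega
      · exact absurd hab (hc' _).2.2.2.2
      · exact absurd hab.symm hxy.ne
      · exact absurd hab.symm (hc' _).2.2.2.2
      · omega
    · intro i hi
      rcases i with _ | i
      · simpa [hβ0] using hxp
      · have h : i < k - 1 := by omega
        simpa [h] using (hc' ⟨i, h⟩).2.2.1.symm
    · intro i hi
      by_cases h : i < k - 1
      · simpa [h] using (hc' ⟨i, h⟩).2.1
      · obtain rfl : i = k - 1 := by omega
        simpa [hβk] using hyq.symm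
  refine hG.false_of_seq (by omega) (fun i => if i % 2 = 0 then α (i / 2) else β (i / 2)) ?_ ?_ ?_
  · intro a ha b hb hab
    simp only [Set.mem_Iio] at ha hb
    dsimp only at hab
    split_ifs at hab with h1 h2 h2
    · have := hαi (show a / 2 < _ by omega) (show b / 2 < _ by omega) hab
      omega
    · exact absurd (hab ▸ hβP _) (hαP _)
    · exact absurd (hab.symm ▸ hβP _) (hαP (b / 2))
    · have := hβi (show a / 2 < _ by omega) (show b / 2 < _ by omega) hab
      omega
  · intro i hi
    obtain ⟨j, rfl | rfl⟩ : ∃ j, i = 2 * j ∨ i = 2 * j + 1 := ⟨i / 2, by omega⟩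
    · have := hαl j (by omega)
      simpa [Nat.add_mod, show (2 * j + 1) / 2 = j by omega] using this
    · have := hαr j (by omega)
      simpa [Nat.add_mod, show (2 * j + 1) / 2 = j by omega,
        show (2 * j + 1 + 1) / 2 = j + 1 by omega, show (2 * j + 1 + 1) % 2 = 0 by omega] using this
  · simpa [hα0, hαk] using hxy.symm

theorem degIn_add_degIn_le (p q : V) (Q : Finset V) :
    degIn G p Q + degIn G q Q ≤ Q.card + (Q.filter fun w => G.Adj p w ∧ G.Adj q w).card := by
  have h := Finset.card_union_add_card_inter (Q.filter fun w => G.Adj p w)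
    (Q.filter fun w => G.Adj q w)
  rw [← Finset.filter_or, ← Finset.filter_and] at h
  have := Finset.card_filter_le Q fun w => G.Adj p w ∨ G.Adj q w
  unfold degIn
  omega

variable (G) in
/-- A vertex set maximizing a suitable potential induces a graph of large minimum degree that has
lost few edges. -/
theorem exists_core [Fintype V] : ∃ S : Finset V, (∀ u ∈ S, S.card + 2 ≤ 3 * degIn G u S) ∧
    3 * (adjPairs G Finset.univ Finset.univ : ℤ) - (Fintype.card V : ℤ) ^ 2 - 5 * Fintype.card V ≤
      3 * adjPairs G S S - (S.card : ℤ) ^ 2 - 5 * S.card := by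
  obtain ⟨S, -, hS⟩ := Finset.exists_max_image (Finset.univ : Finset (Finset V))
    (fun S => 3 * (adjPairs G S S : ℤ) - (S.card : ℤ) ^ 2 - 5 * S.card) Finset.univ_nonempty
  refine ⟨S, fun u hu => ?_, hS _ (Finset.mem_univ _)⟩
  have h := hS (S.erase u) (Finset.mem_univ _)
  have h1 := adjPairs_erase G hu
  have h2 := Finset.card_erase_add_one hu
  zify at h1 h2 ⊢
  rw [h1, ← h2] at h
  rw [← h2]
  nlinarith

variable (G) in
theorem exists_max_cut (S : Finset V) : ∃ A B : Finset V, Disjoint A B ∧ A ∪ B = S ∧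
    (∀ C D, Disjoint C D → C ∪ D = S → adjPairs G C D ≤ adjPairs G A B) ∧
    (∀ u ∈ A, degIn G u S ≤ 2 * degIn G u B) ∧ ∀ u ∈ B, degIn G u S ≤ 2 * degIn G u A := by
  obtain ⟨A, hA, hmax⟩ := Finset.exists_max_image S.powerset
    (fun C => adjPairs G C (S \ C)) ⟨∅, by simp⟩
  rw [Finset.mem_powerset] at hA
  have hmax' : ∀ C D, Disjoint C D → C ∪ D = S → adjPairs G C D ≤ adjPairs G A (S \ A) := by
    intro C D hCD hS
    have : S \ C = D := by
      rw [← hS, Finset.union_sdiff_cancel_left hCD]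
    have h := hmax C (by rw [Finset.mem_powerset, ← hS]; exact Finset.subset_union_left)
    simpa only [this] using h
  have key : ∀ A B : Finset V, Disjoint A B → A ∪ B = S →
      (∀ C D, Disjoint C D → C ∪ D = S → adjPairs G C D ≤ adjPairs G A B) →
      ∀ u ∈ A, degIn G u S ≤ 2 * degIn G u B := by
    intro A B hAB hS hmax u hu
    have huB : u ∉ B := Finset.disjoint_left.1 hAB hu
    have hd : Disjoint B {u} := Finset.disjoint_singleton_right.2 huB
    have hd' : Disjoint (A.erase u) {u} := by simp
    have hAu : A.erase u ∪ {u} = A := by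
      rw [Finset.union_comm, ← Finset.insert_eq, Finset.insert_erase hu]
    have h := hmax (A.erase u) (B ∪ {u})
      (Finset.disjoint_union_right.2 ⟨hAB.mono_left (Finset.erase_subset _ _), hd'⟩)
      (by rw [← hS]; nth_rewrite 2 [← hAu]; ac_rfl)
    rw [adjPairs_union_right G hd, adjPairs_singleton_right, degIn_erase_self] at h
    conv_rhs at h => rw [← hAu]
    rw [adjPairs_union_left G hd', adjPairs_singleton_left] at h
    rw [← hS, degIn_union G hAB]
    omega
  refine ⟨A, S \ A, Finset.disjoint_sdiff, Finset.union_sdiff_of_subset hA, hmax', ?_, ?_⟩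
  · exact key _ _ Finset.disjoint_sdiff (Finset.union_sdiff_of_subset hA) hmax'
  · refine key _ _ Finset.sdiff_disjoint (Finset.sdiff_union_of_subset hA) fun C D hCD hS => ?_
    rw [adjPairs_comm, adjPairs_comm G (S \ A)]
    exact hmax' _ _ hCD.symm (by rw [Finset.union_comm, hS])

/-- The cut given by the neighbourhood of a vertex of maximum degree contains most edges. -/
theorem CycleFree.exists_large_cut {k : ℕ} (hk : 2 ≤ k) (hG : CycleFree G (2 * k + 1))
    {S : Finset V} (hS : S.Nonempty) : ∃ A B : Finset V, Disjoint A B ∧ A ∪ B = S ∧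
      4 * (adjPairs G S S : ℤ) ≤ 4 * adjPairs G A B + ((S.card : ℤ) + 4 * (k - 1)) ^ 2 := by
  obtain ⟨v, -, hmax⟩ := Finset.exists_max_image S (fun u => degIn G u S) hS
  set A := S.filter fun w => G.Adj v w with hA
  have hAS : A ⊆ S := Finset.filter_subset _ _
  have hd : Disjoint A (S \ A) := Finset.disjoint_sdiff
  have hu : A ∪ S \ A = S := Finset.union_sdiff_of_subset hAS
  refine ⟨A, S \ A, hd, hu, ?_⟩
  have h1 := hG.adjPairs_neighbors_le hk v A fun u hu => (Finset.mem_filter.1 hu).2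
  have h2 : adjPairs G (S \ A) S ≤ (S \ A).card * A.card := by
    rw [← smul_eq_mul]
    exact Finset.sum_le_card_nsmul _ _ _ fun u hu => hmax u (Finset.sdiff_subset hu)
  have h3 := adjPairs_union_self G hd
  have h4 := adjPairs_union_right G hd (S \ A)
  have h5 := Finset.card_union_of_disjoint hd
  rw [hu] at h3 h4 h5
  rw [adjPairs_comm G (S \ A) A] at h4
  rw [h5]
  obtain ⟨k, rfl⟩ : ∃ l, k = l + 2 := ⟨k - 2, by omega⟩
  rw [show 2 * (k + 2) - 2 = 2 * k + 2 by omega] at h1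
  zify at h1 h2 h3 h4
  push_cast
  nlinarith [sq_nonneg ((A.card : ℤ) - (S \ A).card - 4 * (k + 1))]

/-- If a partition of a vertex set cuts almost all edges and every vertex has many neighbours in
the other part, then there is no edge inside a part. -/
theorem CycleFree.not_adj_of_dense_cut {k : ℕ} (hk : 2 ≤ k) (hG : CycleFree G (2 * k + 1))
    {A B : Finset V} (hAB : Disjoint A B) {M : ℕ} (hM : 6 * k + 6 ≤ M)
    (hA : ∀ u ∈ A, M + 2 ≤ 6 * degIn G u B) (hB : ∀ u ∈ B, M + 2 ≤ 6 * degIn G u A)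
    (hcut : 12 * ((A.card : ℤ) * B.card - adjPairs G A B) <
      ((M : ℤ) + 8 - 6 * k) * ((A.card : ℤ) - k))
    {x y : V} (hx : x ∈ A) (hy : y ∈ A) : ¬ G.Adj x y := by
  intro hxy
  have hcardA : k + 1 ≤ A.card := by
    have h := hA x hx
    obtain ⟨b, hb⟩ : B.Nonempty := by
      rw [Finset.nonempty_iff_ne_empty]
      rintro rfl
      simp [degIn] at h
    have := hB b hb
    have := degIn_le_card G b A
    omega
  set P := B.filter fun b => A.card + k + 1 ≤ 2 * degIn G b A with hP
  set R := B.filter fun b => ¬ A.card + k + 1 ≤ 2 * degIn G b A with hR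
  have hPR : Disjoint P R := Finset.disjoint_filter_filter_not _ _ _
  have hPRB : P ∪ R = B := Finset.filter_union_filter_not_eq _ _
  have hbad : (R.card : ℤ) * ((A.card : ℤ) - k) ≤
      2 * ((A.card : ℤ) * B.card - adjPairs G A B) := by
    have h1 : 2 * adjPairs G R A ≤ R.card * (A.card + k) := by
      unfold adjPairs
      rw [Finset.mul_sum, ← smul_eq_mul]
      refine Finset.sum_le_card_nsmul _ _ _ fun u hu => ?_
      have := (Finset.mem_filter.1 hu).2
      omega
    have h2 := adjPairs_le_mul G P A
    have h3 : adjPairs G A B = adjPairs G P A + adjPairs G R A := by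
      rw [adjPairs_comm, ← hPRB, adjPairs_union_left G hPR]
    have h4 : B.card = P.card + R.card := by
      rw [← hPRB, Finset.card_union_of_disjoint hPR]
    rw [h3, h4]
    zify at h1 h2
    push_cast
    nlinarith
  have hgood : ∀ u ∈ A, k ≤ degIn G u P := by
    intro u hu
    by_contra! hlt
    have h1 := hA u hu
    rw [← hPRB, degIn_union G hPR] at h1
    have h2 := degIn_le_card G u R
    have h3 : (M : ℤ) + 8 - 6 * k ≤ 6 * R.card := by omega
    have h4 := mul_le_mul_of_nonneg_right h3 (show (0 : ℤ) ≤ (A.card : ℤ) - k by omega)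
    nlinarith
  have hxP : x ∉ P := fun h => Finset.disjoint_left.1 hAB hx (Finset.mem_filter.1 h).1
  have hyP : y ∉ P := fun h => Finset.disjoint_left.1 hAB hy (Finset.mem_filter.1 h).1
  obtain ⟨p, hp⟩ : (P.filter fun w => G.Adj x w).Nonempty :=
    Finset.card_pos.1 (lt_of_lt_of_le (by omega) (hgood x hx))
  obtain ⟨q, hq, hqp⟩ := Finset.exists_mem_ne (lt_of_lt_of_le (by omega) (hgood y hy)) p
  rw [Finset.mem_filter] at hp hq
  refine hG.false_of_common_neighbors hk (hAB.symm.mono_left (Finset.filter_subset _ _))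
    ((hgood x hx).trans (degIn_le_card G x P)) ?_ hxy hxP hyP hp.1 hq.1 hqp.symm hp.2 hq.2
  intro p hp q hq
  have h1 := (Finset.mem_filter.1 hp).2
  have h2 := (Finset.mem_filter.1 hq).2
  have h3 := degIn_add_degIn_le (G := G) p q A
  omega


theorem adjPairs_le_of_bipartite {A B : Finset V} (hAB : Disjoint A B)
    (hA : ∀ x ∈ A, ∀ y ∈ A, ¬ G.Adj x y) (hB : ∀ x ∈ B, ∀ y ∈ B, ¬ G.Adj x y) :
    adjPairs G (A ∪ B) (A ∪ B) ≤ 2 * (A.card * B.card) := by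
  rw [adjPairs_union_self G hAB, adjPairs_self_eq_zero hA, adjPairs_self_eq_zero hB]
  have := adjPairs_le_mul G A B
  omega

theorem two_mul_adjPairs_le_sq {A B W : Finset V} (hW : W ⊆ A ∪ B) (hAB : Disjoint A B)
    (hA : ∀ x ∈ A, ∀ y ∈ A, ¬ G.Adj x y) (hB : ∀ x ∈ B, ∀ y ∈ B, ¬ G.Adj x y) :
    2 * (adjPairs G W W : ℤ) ≤ (W.card : ℤ) ^ 2 := by
  have hd : Disjoint (W ∩ A) (W ∩ B) :=
    hAB.mono Finset.inter_subset_right Finset.inter_subset_right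
  have hu : W ∩ A ∪ W ∩ B = W := by
    rw [← Finset.inter_union_distrib_left, Finset.inter_eq_left.2 hW]
  have h1 := adjPairs_le_of_bipartite hd
    (fun x hx y hy => hA x (Finset.mem_inter.1 hx).2 y (Finset.mem_inter.1 hy).2)
    (fun x hx y hy => hB x (Finset.mem_inter.1 hx).2 y (Finset.mem_inter.1 hy).2)
  have h2 := Finset.card_union_of_disjoint hd
  rw [hu] at h1 h2
  rw [h2]
  zify at h1
  push_cast
  nlinarith [sq_nonneg (((W ∩ A).card : ℤ) - (W ∩ B).card)]

theorem dense_cut_bound {n t k M a b I c : ℤ} (hk : 2 ≤ k) (ht : 1 ≤ t)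
    (hn : 78 * k + 312 * (t - 1) ≤ n) (hM0 : 0 ≤ M) (hMn : M ≤ n) (hab : a + b = M)
    (hI : 2 * M ^ 2 + 10 * M + n ^ 2 - (6 * t + 16) * n + 9 * t ^ 2 + 24 * t + 12 ≤ 6 * I)
    (hc : 4 * I ≤ 4 * c + (M + 4 * (k - 1)) ^ 2) :
    12 * (a * b - c) < (M + 8 - 6 * k) * (a - k) := by
  obtain rfl : b = M - a := by linarith
  have h1 : 0 ≤ (24 * a - (11 * M + 6 * k - 8)) ^ 2 := sq_nonneg _
  have h2 : 0 ≤ (n - M) * (73 * (n + M) + 1332 * k - 2288) :=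
    mul_nonneg (by linarith) (by nlinarith)
  have h3 : 0 ≤ (n - 78 * k - 312 * (t - 1)) * n := mul_nonneg (by linarith) (by linarith)
  have h4 : 0 ≤ (n - 78 * k) * n := mul_nonneg (by linarith) (by linarith)
  have h5 : 0 ≤ (n - 78 * k) * k := mul_nonneg (by linarith) (by linarith)
  have h6 : 0 ≤ (n - 156) * n := mul_nonneg (by linarith) (by linarith)
  have h7 : 0 ≤ (t - 1) ^ 2 := sq_nonneg _
  nlinarith

theorem third_le_core {n t M I : ℤ} (ht : 1 ≤ t) (hn : 156 + 312 * (t - 1) ≤ n) (hM0 : 0 ≤ M)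
    (hIM : I ≤ M ^ 2)
    (hI : 2 * M ^ 2 + 10 * M + n ^ 2 - (6 * t + 16) * n + 9 * t ^ 2 + 24 * t + 12 ≤ 6 * I) :
    n ≤ 3 * M := by
  by_contra! h
  have h1 : 0 ≤ (n - 3 * M) * (n + 3 * M) := mul_nonneg (by linarith) (by linarith)
  have h3 : 0 ≤ (n - 156 - 312 * (t - 1)) * n := mul_nonneg (by linarith) (by linarith)
  have h6 : 0 ≤ (n - 156) * n := mul_nonneg (by linarith) (by linarith)
  have h7 : 0 ≤ (t - 1) ^ 2 := sq_nonneg _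
  nlinarith

theorem core_deficit {n t M I : ℤ} (ht : 1 ≤ t) (hn : 156 + 312 * (t - 1) ≤ n) (hM : n ≤ 3 * M)
    (hIM : 2 * I ≤ M ^ 2)
    (hI : 2 * M ^ 2 + 10 * M + n ^ 2 - (6 * t + 16) * n + 9 * t ^ 2 + 24 * t + 12 ≤ 6 * I) :
    n ≤ M + 3 * (t + 1) := by
  by_contra! h
  have h1 : 0 ≤ (n - (3 * t + 4) - M) * (n - (3 * t + 4) + M - 10) :=
    mul_nonneg (by linarith) (by linarith)
  nlinarith

/-- A `C_{2k+1}`-free graph with many edges contains a large bipartite induced subgraph of large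
minimum degree. -/
theorem CycleFree.exists_bipartite_core [Fintype V] {k n t : ℕ} (hk : 2 ≤ k) (ht : 1 ≤ t)
    (hn : 78 * (k : ℤ) + 312 * ((t : ℤ) - 1) ≤ n) (hcard : Fintype.card V = n)
    (hG : CycleFree G (2 * k + 1))
    (hI : (n : ℤ) ^ 2 - 2 * (t + 1) * n + 3 * t ^ 2 + 8 * t + 4 ≤
      2 * adjPairs G Finset.univ Finset.univ) :
    ∃ A B : Finset V, Disjoint A B ∧ (∀ x ∈ A, ∀ y ∈ A, ¬ G.Adj x y) ∧
      (∀ x ∈ B, ∀ y ∈ B, ¬ G.Adj x y) ∧ n ≤ (A ∪ B).card + 3 * (t + 1) ∧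
      (∀ u ∈ A ∪ B, (A ∪ B).card + 2 ≤ 3 * degIn G u (A ∪ B)) ∧
      2 * ((A ∪ B).card : ℤ) ^ 2 + 10 * (A ∪ B).card + (n : ℤ) ^ 2 - (6 * t + 16) * n +
        9 * t ^ 2 + 24 * t + 12 ≤ 6 * adjPairs G (A ∪ B) (A ∪ B) := by
  obtain ⟨S, hdeg, hS⟩ := exists_core G
  rw [hcard] at hS
  have hI' : 2 * (S.card : ℤ) ^ 2 + 10 * S.card + (n : ℤ) ^ 2 - (6 * t + 16) * n +
      9 * t ^ 2 + 24 * t + 12 ≤ 6 * adjPairs G S S := by nlinarith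
  have hk' : (2 : ℤ) ≤ k := by exact_mod_cast hk
  have ht' : (1 : ℤ) ≤ t := by exact_mod_cast ht
  have hIM : (adjPairs G S S : ℤ) ≤ (S.card : ℤ) ^ 2 := by
    have := adjPairs_le_mul G S S
    zify at this
    linarith
  have hM : (n : ℤ) ≤ 3 * S.card :=
    third_le_core ht' (by linarith) (by positivity) hIM hI'
  have hMn : (S.card : ℤ) ≤ n := by
    rw [← hcard]
    exact_mod_cast S.card_le_univ
  have hSne : S.Nonempty := Finset.card_pos.1 (by omega)
  obtain ⟨A₀, B₀, hd₀, hu₀, hcut₀⟩ := hG.exists_large_cut hk hSne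
  obtain ⟨A, B, hd, rfl, hmax, hA, hB⟩ := exists_max_cut G S
  have hcut : 4 * (adjPairs G (A ∪ B) (A ∪ B) : ℤ) ≤
      4 * adjPairs G A B + (((A ∪ B).card : ℤ) + 4 * (k - 1)) ^ 2 := by
    have := hmax _ _ hd₀ hu₀
    zify at this
    linarith
  have hAB := Finset.card_union_of_disjoint hd
  have hA' : ∀ u ∈ A, (A ∪ B).card + 2 ≤ 6 * degIn G u B := fun u hu => by
    have h1 := hA u hu
    have h2 := hdeg u (Finset.mem_union_left _ hu)
    omega
  have hB' : ∀ u ∈ B, (A ∪ B).card + 2 ≤ 6 * degIn G u A := fun u hu => by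
    have h1 := hB u hu
    have h2 := hdeg u (Finset.mem_union_right _ hu)
    omega
  have hAi : ∀ x ∈ A, ∀ y ∈ A, ¬ G.Adj x y := fun x hx y hy =>
    hG.not_adj_of_dense_cut hk hd (M := (A ∪ B).card) (by omega) hA' hB'
      (dense_cut_bound hk' ht' hn (by positivity) hMn (by omega) hI' hcut) hx hy
  have hBi : ∀ x ∈ B, ∀ y ∈ B, ¬ G.Adj x y := fun x hx y hy =>
    hG.not_adj_of_dense_cut hk hd.symm (M := (A ∪ B).card) (by omega) hB' hA'
      (by
        rw [adjPairs_comm G B A]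
        exact dense_cut_bound hk' ht' hn (by positivity) hMn (by omega) hI' hcut) hx hy
  refine ⟨A, B, hd, hAi, hBi, ?_, hdeg, hI'⟩
  have := core_deficit ht' (by linarith) hM (two_mul_adjPairs_le_sq subset_rfl hd hAi hBi) hI'
  omega

theorem part_card_bounds {n t M a b I : ℝ} (ht : 1 ≤ t) (hn : 156 + 312 * (t - 1) ≤ n)
    (hMn : M ≤ n) (hM : n ≤ M + 3 * (t + 1)) (hab : a + b = M) (hIab : I ≤ 2 * (a * b))
    (hI : 2 * M ^ 2 + 10 * M + n ^ 2 - (6 * t + 16) * n + 9 * t ^ 2 + 24 * t + 12 ≤ 6 * I) :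
    n / 2 - 2 * √(t * n) ≤ a ∧ a ≤ M / 2 + √(t * n) := by
  have htn : 0 ≤ t * n := mul_nonneg (by linarith) (by linarith)
  have hr := Real.sq_sqrt htn
  have hr0 := Real.sqrt_nonneg (t * n)
  have h1 : (a - M / 2) ^ 2 ≤ t * n := by
    obtain rfl : b = M - a := by linarith
    have : 0 ≤ (n - M) * (n + M - 10) := mul_nonneg (by linarith) (by linarith)
    nlinarith
  have h2 := Real.abs_le_sqrt h1
  rw [abs_le] at h2
  have h3 : 3 * t ≤ √(t * n) := by
    apply Real.le_sqrt_of_sq_le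
    nlinarith
  constructor <;> linarith

theorem common_neighbors_bound {n t k M : ℝ} (hk : 2 ≤ k) (ht : 1 ≤ t)
    (hn : 78 * k + 312 * (t - 1) ≤ n) (hM : n ≤ M + 3 * (t + 1)) :
    M / 2 + √(t * n) + k + 1 ≤ 2 * (M + 2) / 3 := by
  have h1 : √(t * n) ≤ n / 12 := by
    rw [Real.sqrt_le_left (by linarith)]
    nlinarith
  linarith

theorem few_low_degree_aux {n t M I l : ℝ} (ht : 1 ≤ t) (hn : 156 + 312 * (t - 1) ≤ n)
    (hMn : M ≤ n) (hM : n ≤ M + 3 * (t + 1)) (hl : √(t * n) < l) (hl' : l ≤ √(t * n) + 1)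
    (hI : 2 * M ^ 2 + 10 * M + n ^ 2 - (6 * t + 16) * n + 9 * t ^ 2 + 24 * t + 12 ≤ 6 * I) :
    (M - l) ^ 2 / 2 + 2 * (l * (n / 2 - √(3 * t * n))) < I := by
  have htn : 0 ≤ t * n := mul_nonneg (by linarith) (by linarith)
  have hr := Real.sq_sqrt htn
  have hr0 := Real.sqrt_nonneg (t * n)
  set r := √(t * n) with hrdef
  have hq : 17 / 10 * r ≤ √(3 * t * n) := by
    apply Real.le_sqrt_of_sq_le
    nlinarith
  have hr12 : 12 ≤ r := Real.le_sqrt_of_sq_le (by nlinarith)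
  have hrn : r ≤ n / 12 := by
    rw [hrdef, Real.sqrt_le_left (by linarith)]
    nlinarith
  have h1 : l * (17 / 10 * r) ≤ l * √(3 * t * n) :=
    mul_le_mul_of_nonneg_left hq (by linarith)
  have h2 : 0 ≤ (n - M) * (n / 3 - l) := mul_nonneg (by linarith) (by linarith)
  have h3 : 0 ≤ (n - M) * (n + M) := mul_nonneg (by linarith) (by linarith)
  have h4 : 0 ≤ (l - r) * (r + 1 - l) := mul_nonneg (by linarith) (by linarith)
  have h5 : 0 ≤ (l - r) * r := mul_nonneg (by linarith) hr0
  have h6 : 0 ≤ (r - 12) * r := mul_nonneg (by linarith) hr0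
  have h7 : 0 ≤ (t - 1) * n := mul_nonneg (by linarith) (by linarith)
  nlinarith

theorem few_low_degree {n t : ℝ} (ht : 1 ≤ t) (hn : 156 + 312 * (t - 1) ≤ n) {A B : Finset V}
    (hAB : Disjoint A B) (hA : ∀ x ∈ A, ∀ y ∈ A, ¬ G.Adj x y)
    (hB : ∀ x ∈ B, ∀ y ∈ B, ¬ G.Adj x y) (hMn : ((A ∪ B).card : ℝ) ≤ n)
    (hM : n ≤ (A ∪ B).card + 3 * (t + 1))
    (hI : 2 * ((A ∪ B).card : ℝ) ^ 2 + 10 * (A ∪ B).card + n ^ 2 - (6 * t + 16) * n +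
      9 * t ^ 2 + 24 * t + 12 ≤ 6 * adjPairs G (A ∪ B) (A ∪ B))
    {L : Finset V} (hL : L ⊆ A ∪ B)
    (hlow : ∀ u ∈ L, (degIn G u (A ∪ B) : ℝ) ≤ n / 2 - √(3 * t * n)) :
    (L.card : ℝ) ≤ √(t * n) := by
  by_contra! hlt
  obtain ⟨K, hKL, hK⟩ := Finset.exists_subset_card_eq
    (Nat.succ_le_of_lt ((Nat.floor_lt (Real.sqrt_nonneg _)).2 hlt))
  have hK1 : √(t * n) < K.card := by
    rw [hK]
    exact_mod_cast Nat.lt_succ_floor _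
  have hK2 : (K.card : ℝ) ≤ √(t * n) + 1 := by
    rw [hK]
    push_cast
    linarith [Nat.floor_le (Real.sqrt_nonneg (t * n))]
  have haux := few_low_degree_aux ht hn hMn hM hK1 hK2 hI
  set S := A ∪ B with hS
  have hKS := hKL.trans hL
  have hd : Disjoint K (S \ K) := Finset.disjoint_sdiff
  have hu : K ∪ S \ K = S := Finset.union_sdiff_of_subset hKS
  have h1 := adjPairs_union_self G hd
  have h2 := adjPairs_union_right G hd K
  have h3 := Finset.card_union_of_disjoint hd
  rw [hu] at h1 h2 h3
  have h4 : (adjPairs G K S : ℝ) ≤ K.card * (n / 2 - √(3 * t * n)) := by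
    unfold adjPairs
    push_cast
    rw [← nsmul_eq_mul]
    exact Finset.sum_le_card_nsmul _ _ _ fun u hu => hlow u (hKL hu)
  have h5 : 2 * (adjPairs G (S \ K) (S \ K) : ℝ) ≤ ((S \ K).card : ℝ) ^ 2 := by
    exact_mod_cast two_mul_adjPairs_le_sq Finset.sdiff_subset hAB hA hB
  have h6 : ((S \ K).card : ℝ) = S.card - K.card := by
    rw [h3]
    push_cast
    ring
  rw [h6] at h5
  have h1' : (adjPairs G S S : ℝ) =
    adjPairs G K K + 2 * adjPairs G K (S \ K) + adjPairs G (S \ K) (S \ K) := by exact_mod_cast h1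
  have h2' : (adjPairs G K S : ℝ) = adjPairs G K K + adjPairs G K (S \ K) := by exact_mod_cast h2
  have h7 : (0 : ℝ) ≤ adjPairs G K K := by positivity
  linarith

theorem degIn_union_left_of_indep {A B : Finset V} (hAB : Disjoint A B)
    (hA : ∀ x ∈ A, ∀ y ∈ A, ¬ G.Adj x y) {u : V} (hu : u ∈ A) :
    degIn G u (A ∪ B) = degIn G u B := by
  rw [degIn_union G hAB, Nat.add_eq_right, degIn, Finset.card_eq_zero,
    Finset.filter_eq_empty_iff]
  exact fun w hw => hA u hu w hw

/-- A vertex outside a dense bipartite graph has neighbours in at most one of its parts. -/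
theorem CycleFree.not_adj_of_adj_of_bipartite {k : ℕ} (hk : 2 ≤ k) (hG : CycleFree G (2 * k + 1))
    {A B : Finset V} (hAB : Disjoint A B) (hA : ∀ x ∈ A, ∀ y ∈ A, ¬ G.Adj x y)
    (hB : ∀ x ∈ B, ∀ y ∈ B, ¬ G.Adj x y)
    (hdeg : ∀ u ∈ A ∪ B, (A ∪ B).card + 2 ≤ 3 * degIn G u (A ∪ B))
    (hcom : 3 * (B.card + k + 1) ≤ 2 * ((A ∪ B).card + 2)) (hM : 3 * k ≤ (A ∪ B).card)
    {v x y : V} (hv : v ∉ A) (hx : x ∈ A) (hy : y ∈ B) (hvx : G.Adj v x) : ¬ G.Adj v y := by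
  intro hvy
  have hdA : ∀ u ∈ A, (A ∪ B).card + 2 ≤ 3 * degIn G u B := fun u hu => by
    rw [← degIn_union_left_of_indep hAB hA hu]
    exact hdeg u (Finset.mem_union_left _ hu)
  have hdB : (A ∪ B).card + 2 ≤ 3 * degIn G y A := by
    rw [← degIn_union_left_of_indep hAB.symm hB hy, Finset.union_comm B A]
    exact hdeg y (Finset.mem_union_right _ hy)
  obtain ⟨q, hq, hqx⟩ := Finset.exists_mem_ne
    (show 1 < (A.filter fun w => G.Adj y w).card by unfold degIn at hdB; omega) x
  rw [Finset.mem_filter] at hq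
  refine hG.false_of_common_neighbors hk hAB (by have := degIn_le_card G y A; omega) ?_ hvy hv
    (fun h => Finset.disjoint_left.1 hAB h hy) hx hq.1 hqx.symm hvx hq.2
  intro p hp q hq
  have h1 := hdA p hp
  have h2 := hdA q hq
  have h3 := degIn_add_degIn_le (G := G) p q B
  omega

end Counting

/-- Structure lemma: for a `C_{2k+1}`-free graph `G` on `n ≥ 78t²k` vertices with
`e(G) ≥ ⌊(n-t-1)²/4⌋ + C(t+2,2)` there is a set `T` of at most `3(t+1)` vertices such that
`G - T` is bipartite with parts `X`, `Y` and conditions (i)-(iv) hold.  Here the degree of a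
vertex `u ∉ T` in `G - T` is `|N_G(u) \ T|`. -/
theorem stmt11 {V : Type*} [Fintype V] [DecidableEq V]
    (k n t : ℕ) (hk : 2 ≤ k) (ht1 : 1 ≤ t) (ht2 : t ≤ 2 * k - 2)
    (hn : 78 * t ^ 2 * k ≤ n)
    (G : SimpleGraph V) [DecidableRel G.Adj]
    (hcard : Fintype.card V = n)
    (hfree : CycleFree G (2 * k + 1))
    (hedge : (n - t - 1) ^ 2 / 4 + (t + 2).choose 2 ≤ G.edgeFinset.card) :
    ∃ T X Y : Finset V,
      T.card ≤ 3 * (t + 1) ∧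
      Disjoint X Y ∧ X ∪ Y = Tᶜ ∧
      (∀ x ∈ X, ∀ y ∈ X, ¬ G.Adj x y) ∧
      (∀ x ∈ Y, ∀ y ∈ Y, ¬ G.Adj x y) ∧
      -- (i) minimum degree of G - T
      (∀ u, u ∉ T → ((n : ℝ) - 3 * t - 1) / 3 ≤ ((G.neighborFinset u \ T).card : ℝ)) ∧
      -- (ii) sizes of the parts
      ((n : ℝ) / 2 - 2 * Real.sqrt (t * n) ≤ (X.card : ℝ) ∧
        (X.card : ℝ) ≤ (n : ℝ) / 2 + Real.sqrt (3 * t * n)) ∧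
      ((n : ℝ) / 2 - 2 * Real.sqrt (t * n) ≤ (Y.card : ℝ) ∧
        (Y.card : ℝ) ≤ (n : ℝ) / 2 + Real.sqrt (3 * t * n)) ∧
      -- (iii) few vertices of small degree in G - T
      (({u : V | u ∉ T ∧ ((G.neighborFinset u \ T).card : ℝ) ≤
          (n : ℝ) / 2 - Real.sqrt (3 * t * n)}.ncard : ℝ) ≤ Real.sqrt (t * n)) ∧
      -- (iv) neighbors of vertices of T in X ∪ Y lie in one part
      (∀ v ∈ T, (∀ w, G.Adj v w → w ∈ X ∪ Y → w ∈ X) ∨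
        (∀ w, G.Adj v w → w ∈ X ∪ Y → w ∈ Y)) := by
  have hkZ : (2 : ℤ) ≤ k := by exact_mod_cast hk
  have htZ : (1 : ℤ) ≤ t := by exact_mod_cast ht1
  have hnZ : 78 * (k : ℤ) + 312 * ((t : ℤ) - 1) ≤ n := by
    zify at hn
    have h1 : 0 ≤ ((t : ℤ) ^ 2 - 1) * (k - 2) := mul_nonneg (by nlinarith) (by linarith)
    nlinarith [sq_nonneg ((t : ℤ) - 1)]
  have hnR : 78 * (k : ℝ) + 312 * ((t : ℝ) - 1) ≤ n := by exact_mod_cast hnZ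
  have hkR : (2 : ℝ) ≤ k := by exact_mod_cast hk
  have htR : (1 : ℝ) ≤ t := by exact_mod_cast ht1
  have hnR' : 156 + 312 * ((t : ℝ) - 1) ≤ n := by linarith
  obtain ⟨A, B, hAB, hA, hB, hM, hdeg, hI⟩ := hfree.exists_bipartite_core hk ht1 hnZ hcard
    (four_mul_edges_le_two_mul_adjPairs (by omega) hedge)
  have hMR : (n : ℝ) ≤ (A ∪ B).card + 3 * (t + 1) := by exact_mod_cast hM
  have hMn : (A ∪ B).card ≤ n := hcard ▸ Finset.card_le_univ _
  have hMnR : ((A ∪ B).card : ℝ) ≤ n := by exact_mod_cast hMn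
  have hIR : 2 * ((A ∪ B).card : ℝ) ^ 2 + 10 * (A ∪ B).card + (n : ℝ) ^ 2 - (6 * t + 16) * n +
      9 * t ^ 2 + 24 * t + 12 ≤ 6 * adjPairs G (A ∪ B) (A ∪ B) := by exact_mod_cast hI
  have hcardAB : (A.card : ℝ) + B.card = (A ∪ B).card := by
    exact_mod_cast (Finset.card_union_of_disjoint hAB).symm
  have hIab : (adjPairs G (A ∪ B) (A ∪ B) : ℝ) ≤ 2 * (A.card * B.card) := by
    exact_mod_cast adjPairs_le_of_bipartite hAB hA hB
  obtain ⟨hA1, hA2⟩ := part_card_bounds htR hnR' hMnR hMR hcardAB hIab hIR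
  obtain ⟨hB1, hB2⟩ := part_card_bounds htR hnR' hMnR hMR (by rw [add_comm, hcardAB])
    (by rwa [mul_comm (B.card : ℝ)]) hIR
  have hsqrt : √((t : ℝ) * n) ≤ √(3 * t * n) := by
    apply Real.sqrt_le_sqrt
    nlinarith [mul_nonneg (show (0 : ℝ) ≤ t by linarith) (show (0 : ℝ) ≤ n by linarith)]
  have hcom := common_neighbors_bound hkR htR hnR hMR
  have hcomA : 3 * (A.card + k + 1) ≤ 2 * ((A ∪ B).card + 2) := by
    have : (3 : ℝ) * (A.card + k + 1) ≤ 2 * ((A ∪ B).card + 2) := by linarith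
    exact_mod_cast this
  have hcomB : 3 * (B.card + k + 1) ≤ 2 * ((A ∪ B).card + 2) := by
    have : (3 : ℝ) * (B.card + k + 1) ≤ 2 * ((A ∪ B).card + 2) := by linarith
    exact_mod_cast this
  have hneigh : ∀ u, (G.neighborFinset u \ (A ∪ B)ᶜ).card = degIn G u (A ∪ B) := by
    intro u
    unfold degIn
    congr 1
    ext w
    simp only [Finset.mem_sdiff, Finset.mem_compl, SimpleGraph.mem_neighborFinset,
      Finset.mem_filter, not_not]
    exact and_comm
  refine ⟨(A ∪ B)ᶜ, A, B, ?_, hAB, (compl_compl _).symm, hA, hB, ?_, ⟨hA1, by linarith⟩,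
    ⟨hB1, by linarith⟩, ?_, ?_⟩
  · rw [Finset.card_compl, hcard]
    omega
  · intro u hu
    rw [Finset.mem_compl, not_not] at hu
    rw [hneigh]
    have : ((A ∪ B).card : ℝ) + 2 ≤ 3 * degIn G u (A ∪ B) := by exact_mod_cast hdeg u hu
    linarith
  · classical
    have hset : {u : V | u ∉ (A ∪ B)ᶜ ∧ ((G.neighborFinset u \ (A ∪ B)ᶜ).card : ℝ) ≤
        (n : ℝ) / 2 - √(3 * t * n)} = ((A ∪ B).filter fun u =>
          (degIn G u (A ∪ B) : ℝ) ≤ (n : ℝ) / 2 - √(3 * t * n) : Finset V) := by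
      ext u
      simp only [hneigh, Set.mem_ofPred_eq, Finset.mem_compl, not_not, Finset.coe_filter]
    rw [hset, Set.ncard_coe_finset]
    exact few_low_degree htR hnR' hAB hA hB hMnR hMR hIR (Finset.filter_subset _ _)
      fun u hu => (Finset.mem_filter.1 hu).2
  · intro v hv
    rw [Finset.mem_compl, Finset.mem_union, not_or] at hv
    by_cases h : ∃ x ∈ A, G.Adj v x
    · obtain ⟨x, hx, hvx⟩ := h
      refine Or.inl fun w hvw hw => (Finset.mem_union.1 hw).resolve_right fun hwB => ?_
      exact hfree.not_adj_of_adj_of_bipartite hk hAB hA hB hdeg hcomB (by omega) hv.1 hx hwB hvx hvw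
    · push Not at h
      exact Or.inr fun w hvw hw => (Finset.mem_union.1 hw).resolve_left fun hwA => h w hwA hvw
end

section
/- Let k ≥ 2, and let n, t be integers with 1 ≤ t ≤ 2k−2 and n ≥ 252t²k. Let G be a C_{2k+1}-free graph on n vertices with e(G) ≥ ⌊(n−t−1)²/4⌋ + (t+2 choose 2), and let B = {v ∈ V(G) : deg_G(v) < 2√(tn)}. Then the graph G − B is bipartite and |B| ≤ t+1. -/
section

open Finset

/-- A `Cₘ`-free graph has no closed chain of `m` distinct vertices. -/
theorem CycleFree.not_isChain {V : Type*} {G : SimpleGraph V} {m : ℕ} (hG : CycleFree G m)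
    {a : V} {l : List V} (hl : l.length + 1 = m) (hnd : (a :: l).Nodup) :
    ¬ List.IsChain G.Adj (a :: (l ++ [a])) := by
  intro hc
  rw [List.isChain_iff_getElem] at hc
  have hlen : (a :: l).length = m := by simpa using hl
  have key : ∀ (i j : ℕ) (hi : i < (a :: l).length) (hj : j < (a :: l).length),
      (j = i + 1 ∨ (i + 1 = m ∧ j = 0)) → G.Adj ((a :: l)[i]) ((a :: l)[j]) := by
    intro i j hi hj hij
    have h := hc i (by simp at hi ⊢; omega)
    have e1 : (a :: (l ++ [a]))[i]'(by simp at hi ⊢; omega) = (a :: l)[i] := by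
      have : (a :: (l ++ [a])) = (a :: l) ++ [a] := rfl
      simp only [this]
      rw [List.getElem_append_left]
    rw [e1] at h
    convert h using 1
    have : (a :: (l ++ [a])) = (a :: l) ++ [a] := rfl
    simp only [this]
    rcases hij with rfl | ⟨h1, rfl⟩
    · rw [List.getElem_append_left]
    · rw [List.getElem_append_right (by omega)]
      simp
  let f : Fin m → V := fun i => (a :: l)[i.1]'(by omega)
  have hf : ∀ u v : Fin m, ((u - v : Fin m) : ℕ) = 1 → G.Adj (f v) (f u) := by
    intro u v huv
    apply key
    rw [Fin.sub_def] at huv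
    simp only at huv
    have hu := u.2
    have hv := v.2
    rcases lt_or_ge (m - v.1 + u.1) m with h | h
    · rw [Nat.mod_eq_of_lt h] at huv
      omega
    · rw [Nat.mod_eq_sub_mod h, Nat.mod_eq_of_lt (by omega)] at huv
      omega
  refine hG ⟨f, ?_⟩ ?_
  · intro u v huv
    rw [SimpleGraph.cycleGraph_adj'] at huv
    rcases huv with h | h
    · exact (hf _ _ h).symm
    · exact hf _ _ h
  · intro i j hij
    have := (List.Nodup.getElem_inj_iff hnd).1 hij
    exact Fin.ext this

/-- If every two vertices of `P` have many common neighbours in `Q` and conversely, then any two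
vertices of `P` are joined by paths of every short even length avoiding a small set `F`. -/
theorem exists_even_path {V : Type*} [DecidableEq V] {G : SimpleGraph V} [DecidableRel G.Adj]
    {P Q : Finset V} {K : ℕ}
    (hP : ∀ x ∈ P, ∀ x' ∈ P, K ≤ #{y ∈ Q | G.Adj x y ∧ G.Adj x' y})
    (hQ : ∀ y ∈ Q, K ≤ #{x ∈ P | G.Adj y x}) (j : ℕ) :
    ∀ F : Finset V, #F + (2 * j + 1) ≤ K → ∀ x ∈ P, ∀ x' ∈ P,
      ∃ l : List V, l.length = 2 * j + 1 ∧ l.Nodup ∧ (∀ a ∈ l, a ∉ F) ∧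
        List.IsChain G.Adj (x :: (l ++ [x'])) := by
  induction j with
  | zero =>
    intro F hF x hx x' hx'
    obtain ⟨y, hy, hyF⟩ := exists_mem_notMem_of_card_lt_card
      (lt_of_lt_of_le (by omega : #F < K) (hP x hx x' hx'))
    rw [mem_filter] at hy
    exact ⟨[y], by simp, by simp, by simpa using hyF, by simp [hy.2.1, hy.2.2.symm]⟩
  | succ j ih =>
    intro F hF x hx x' hx'
    obtain ⟨y, hy, hyF⟩ := exists_mem_notMem_of_card_lt_card
      (lt_of_lt_of_le (by omega : #F < K) (hP x hx x' hx'))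
    rw [mem_filter] at hy
    have h1 := card_insert_le y F
    obtain ⟨z, hz, hzF⟩ := exists_mem_notMem_of_card_lt_card
      (lt_of_lt_of_le (by omega : #(insert y F) < K) (hQ y hy.1))
    rw [mem_filter] at hz
    have h2 := card_insert_le z (insert y F)
    obtain ⟨l, hl, hnd, hlF, hc⟩ := ih (insert z (insert y F)) (by omega) z hz.1 x' hx'
    simp only [mem_insert, not_or] at hlF hzF
    refine ⟨y :: z :: l, by simp [hl]; ring, ?_, ?_, ?_⟩
    · simp only [List.nodup_cons, List.mem_cons, not_or]
      exact ⟨⟨fun h => hzF.1 h.symm, fun h => (hlF _ h).2.1 rfl⟩, fun h => (hlF _ h).1 rfl, hnd⟩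
    · intro a ha
      rcases List.mem_cons.1 ha with rfl | ha
      · exact hyF
      rcases List.mem_cons.1 ha with rfl | ha
      · exact hzF.2
      · exact (hlF a ha).2.2
    · simpa [List.isChain_cons_cons, hy.2.1, hz.2] using hc

/-- No edge joins two vertices each having three neighbours in the same side `P` of a core. -/
theorem CycleFree.not_adj_of_three_le {V : Type*} [DecidableEq V] {G : SimpleGraph V}
    [DecidableRel G.Adj] {P Q : Finset V} {k : ℕ} (hk : 2 ≤ k) (hG : CycleFree G (2 * k + 1))
    (hP : ∀ x ∈ P, ∀ x' ∈ P, 2 * k + 1 ≤ #{y ∈ Q | G.Adj x y ∧ G.Adj x' y})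
    (hQ : ∀ y ∈ Q, 2 * k + 1 ≤ #{x ∈ P | G.Adj y x}) {u v : V}
    (hu : 3 ≤ #{x ∈ P | G.Adj u x}) (hv : 3 ≤ #{x ∈ P | G.Adj v x}) : ¬ G.Adj u v := by
  intro huv
  obtain ⟨x, hx, hxv⟩ := exists_mem_notMem_of_card_lt_card
    (lt_of_lt_of_le (by simp : #{v} < 3) hu)
  obtain ⟨y, hy, hyu⟩ := exists_mem_notMem_of_card_lt_card
    (lt_of_le_of_lt (card_le_two : #{u, x} ≤ 2) hv)
  simp only [mem_filter, mem_singleton, mem_insert, not_or] at hx hxv hy hyu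
  obtain ⟨l, hl, hnd, hlF, hc⟩ := exists_even_path hP hQ (k - 2) {u, v, x, y}
    (by have := card_le_four (a := u) (b := v) (c := x) (d := y); omega) x hx.1 y hy.1
  simp only [mem_insert, mem_singleton, not_or] at hlF
  refine hG.not_isChain (a := u) (l := x :: (l ++ [y, v])) (by simp [hl]; omega) ?_ ?_
  · have h1 := huv.ne
    have h2 := hx.2.ne
    have h3 := hy.2.ne
    simp only [List.nodup_cons, List.mem_cons, List.mem_append, List.nodup_append,
      List.not_mem_nil, or_false, not_or]
    refine ⟨⟨h2, fun h => (hlF _ h).1 rfl, fun h => hyu.1 h.symm, h1⟩,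
      ⟨fun h => (hlF _ h).2.2.1 rfl, fun h => hyu.2 h.symm, hxv⟩, hnd, ?_, ?_⟩
    · simp [h3.symm]
    · rintro a ha b (rfl | rfl) rfl
      · exact (hlF _ ha).2.2.2 rfl
      · exact (hlF _ ha).2.1 rfl
  · have e : u :: (x :: (l ++ [y, v]) ++ [u]) = u :: ((x :: l) ++ y :: [v, u]) := by simp
    rw [e]
    have hc' : List.IsChain G.Adj ((x :: l) ++ y :: [v, u]) := by
      rw [List.isChain_split]
      refine ⟨by simpa using hc, by simp [hy.2.symm, huv.symm]⟩
    rw [List.cons_append] at hc' ⊢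
    rw [List.isChain_cons_cons]
    exact ⟨hx.2, hc'⟩

/-- No vertex has neighbours in both sides of a core. -/
theorem CycleFree.not_adj_both {V : Type*} [DecidableEq V] {G : SimpleGraph V}
    [DecidableRel G.Adj] {P Q : Finset V} {k : ℕ} (hk : 2 ≤ k) (hG : CycleFree G (2 * k + 1))
    (hPQ : Disjoint P Q)
    (hP : ∀ x ∈ P, ∀ x' ∈ P, 2 * k + 1 ≤ #{y ∈ Q | G.Adj x y ∧ G.Adj x' y})
    (hQ : ∀ y ∈ Q, 2 * k + 1 ≤ #{x ∈ P | G.Adj y x}) {v x y : V}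
    (hx : x ∈ P) (hy : y ∈ Q) (hvx : G.Adj v x) : ¬ G.Adj v y := by
  intro hvy
  obtain ⟨z, hz, hzv⟩ := exists_mem_notMem_of_card_lt_card
    (lt_of_le_of_lt (card_le_two : #{v, x} ≤ 2) (lt_of_lt_of_le (by omega) (hQ y hy)))
  simp only [mem_filter, mem_insert, mem_singleton, not_or] at hz hzv
  have hxy : x ≠ y := fun h => Finset.disjoint_left.1 hPQ hx (h ▸ hy)
  obtain ⟨l, hl, hnd, hlF, hc⟩ := exists_even_path hP hQ (k - 2) {v, x, z, y}
    (by have := card_le_four (a := v) (b := x) (c := z) (d := y); omega) x hx z hz.1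
  simp only [mem_insert, mem_singleton, not_or] at hlF
  refine hG.not_isChain (a := v) (l := x :: (l ++ [z, y])) (by simp [hl]; omega) ?_ ?_
  · have h1 := hvx.ne
    have h2 := hvy.ne
    have h3 := hz.2.ne
    simp only [List.nodup_cons, List.mem_cons, List.mem_append, List.nodup_append,
      List.not_mem_nil, or_false, not_or]
    refine ⟨⟨h1, fun h => (hlF _ h).1 rfl, fun h => hzv.1 h.symm, h2⟩,
      ⟨fun h => (hlF _ h).2.1 rfl, fun h => hzv.2 h.symm, hxy⟩, hnd, ?_, ?_⟩
    · simp [h3.symm]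
    · rintro a ha b (rfl | rfl) rfl
      · exact (hlF _ ha).2.2.1 rfl
      · exact (hlF _ ha).2.2.2 rfl
  · have e : v :: (x :: (l ++ [z, y]) ++ [v]) = v :: ((x :: l) ++ z :: [y, v]) := by simp
    rw [e]
    have hc' : List.IsChain G.Adj ((x :: l) ++ z :: [y, v]) := by
      rw [List.isChain_split]
      refine ⟨by simpa using hc, by simp [hz.2.symm, hvy.symm]⟩
    rw [List.cons_append] at hc' ⊢
    rw [List.isChain_cons_cons]
    exact ⟨hvx, hc'⟩

/-- Vertices with more than `#(P ∪ Q)ᶜ + 2` neighbours induce a bipartite graph, if `P`, `Q` are the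
sides of a core. -/
theorem CycleFree.induce_colorable_of_core {V : Type*} [Fintype V] [DecidableEq V]
    {G : SimpleGraph V} [DecidableRel G.Adj] {P Q : Finset V} {k : ℕ} (hk : 2 ≤ k)
    (hG : CycleFree G (2 * k + 1)) (hPQ : Disjoint P Q)
    (hP : ∀ x ∈ P, ∀ x' ∈ P, 2 * k + 1 ≤ #{y ∈ Q | G.Adj x y ∧ G.Adj x' y})
    (hQ : ∀ x ∈ Q, ∀ x' ∈ Q, 2 * k + 1 ≤ #{y ∈ P | G.Adj x y ∧ G.Adj x' y})
    {S : Set V} (hS : ∀ v ∈ S, #(P ∪ Q)ᶜ + 3 ≤ G.degree v) : (G.induce S).Colorable 2 := by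
  have hP1 : ∀ x ∈ P, 2 * k + 1 ≤ #{y ∈ Q | G.Adj x y} := fun x hx => by
    simpa using hP x hx x hx
  have hQ1 : ∀ x ∈ Q, 2 * k + 1 ≤ #{y ∈ P | G.Adj x y} := fun x hx => by
    simpa using hQ x hx x hx
  have hdeg : ∀ v ∈ S, 3 ≤ #{x ∈ P | G.Adj v x} + #{x ∈ Q | G.Adj v x} := by
    intro v hv
    have h1 := hS v hv
    rw [← G.card_neighborFinset_eq_degree, G.neighborFinset_eq_filter] at h1
    have h2 : ({w | G.Adj v w} : Finset V) ⊆
        (P ∪ Q)ᶜ ∪ (({x ∈ P | G.Adj v x} : Finset V) ∪ {x ∈ Q | G.Adj v x}) := by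
      intro w
      simp only [mem_filter, mem_univ, true_and, mem_union, mem_compl]
      tauto
    have h3 := card_le_card h2
    have h4 := card_union_le (P ∪ Q)ᶜ (({x ∈ P | G.Adj v x} : Finset V) ∪ {x ∈ Q | G.Adj v x})
    have h5 := card_union_le ({x ∈ P | G.Adj v x} : Finset V) {x ∈ Q | G.Adj v x}
    omega
  have hside : ∀ v ∈ S, (3 ≤ #{x ∈ P | G.Adj v x} ∧ #{x ∈ Q | G.Adj v x} = 0) ∨
      (#{x ∈ P | G.Adj v x} = 0 ∧ 3 ≤ #{x ∈ Q | G.Adj v x}) := by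
    intro v hv
    have h := hdeg v hv
    rcases Nat.eq_zero_or_pos (#{x ∈ P | G.Adj v x}) with h0 | h0
    · right; omega
    rcases Nat.eq_zero_or_pos (#{x ∈ Q | G.Adj v x}) with h1 | h1
    · left; omega
    obtain ⟨x, hx⟩ := card_pos.1 h0
    obtain ⟨y, hy⟩ := card_pos.1 h1
    rw [mem_filter] at hx hy
    exact absurd hy.2 (hG.not_adj_both hk hPQ hP hQ1 hx.1 hy.1 hx.2)
  refine ⟨SimpleGraph.Coloring.mk
    (fun v => if #{x ∈ P | G.Adj v.1 x} = 0 then (0 : Fin 2) else 1) ?_⟩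
  rintro ⟨u, hu⟩ ⟨v, hv⟩ huv
  replace huv : G.Adj u v := huv
  rcases hside u hu with ⟨h1, h2⟩ | ⟨h1, h2⟩ <;> rcases hside v hv with ⟨h3, h4⟩ | ⟨h3, h4⟩
  · exact absurd huv (hG.not_adj_of_three_le hk hP hQ1 h1 h3)
  · simp [h3, show #{x ∈ P | G.Adj u x} ≠ 0 by omega]
  · simp [h1, show #{x ∈ P | G.Adj v x} ≠ 0 by omega]
  · exact absurd huv (hG.not_adj_of_three_le hk hQ hP1 h2 h4)

theorem card_mul_le_of_sum_le {V : Type*} {G : SimpleGraph V} [DecidableRel G.Adj]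
    {X Y : Finset V} {M n : ℕ} (h : #X * #Y ≤ ∑ x ∈ X, #{y ∈ Y | G.Adj x y} + M) :
    n * #{x ∈ X | n < 7 * #{y ∈ Y | ¬ G.Adj x y}} ≤ 7 * M := by
  have h1 : ∑ x ∈ X, #{y ∈ Y | G.Adj x y} + ∑ x ∈ X, #{y ∈ Y | ¬ G.Adj x y} = #X * #Y := by
    rw [← sum_add_distrib, sum_congr rfl (fun x _ => card_filter_add_card_filter_not (G.Adj x)),
      sum_const, smul_eq_mul]
  have h2 : #{x ∈ X | n < 7 * #{y ∈ Y | ¬ G.Adj x y}} • n ≤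
      ∑ x ∈ X with n < 7 * #{y ∈ Y | ¬ G.Adj x y}, 7 * #{y ∈ Y | ¬ G.Adj x y} :=
    card_nsmul_le_sum _ _ _ fun x hx => (mem_filter.1 hx).2.le
  have h3 : ∑ x ∈ X with n < 7 * #{y ∈ Y | ¬ G.Adj x y}, 7 * #{y ∈ Y | ¬ G.Adj x y} ≤
      7 * ∑ x ∈ X, #{y ∈ Y | ¬ G.Adj x y} := by
    rw [mul_sum]
    exact sum_le_sum_of_subset (filter_subset _ _)
  rw [smul_eq_mul, mul_comm] at h2
  omega

theorem card_le_common_neighbors {V : Type*} [DecidableEq V] {G : SimpleGraph V}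
    [DecidableRel G.Adj] {Y L : Finset V} {n : ℕ} {x x' : V}
    (hx : 7 * #{y ∈ Y | ¬ G.Adj x y} ≤ n) (hx' : 7 * #{y ∈ Y | ¬ G.Adj x' y} ≤ n) :
    7 * #Y ≤ 7 * #{y ∈ Y \ L | G.Adj x y ∧ G.Adj x' y} + 7 * #L + 2 * n := by
  have h : Y ⊆ ({y ∈ Y \ L | G.Adj x y ∧ G.Adj x' y} ∪ L) ∪
      (({y ∈ Y | ¬ G.Adj x y} : Finset V) ∪ {y ∈ Y | ¬ G.Adj x' y}) := by
    intro y hy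
    simp only [mem_union, mem_filter, mem_sdiff, hy, true_and]
    tauto
  have h1 := card_le_card h
  have h2 := card_union_le ({y ∈ Y \ L | G.Adj x y ∧ G.Adj x' y} ∪ L)
      (({y ∈ Y | ¬ G.Adj x y} : Finset V) ∪ {y ∈ Y | ¬ G.Adj x' y})
  have h3 := card_union_le {y ∈ Y \ L | G.Adj x y ∧ G.Adj x' y} L
  have h4 := card_union_le ({y ∈ Y | ¬ G.Adj x y} : Finset V) {y ∈ Y | ¬ G.Adj x' y}
  omega

theorem sum_card_adj_comm {V : Type*} {G : SimpleGraph V} [DecidableRel G.Adj] (X Y : Finset V) :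
    ∑ x ∈ X, #{y ∈ Y | G.Adj x y} = ∑ y ∈ Y, #{x ∈ X | G.Adj y x} := by
  simp only [card_filter]
  rw [sum_comm]
  simp only [G.adj_comm]

/-- If a cut misses few of the `n² / 4` possible edges, then there is a small set `L` such that the
vertices of degree larger than `#L + 2` induce a bipartite graph. -/
theorem CycleFree.exists_colorable_of_cut {V : Type*} [Fintype V] [DecidableEq V]
    {G : SimpleGraph V} [DecidableRel G.Adj] {k M n : ℕ} (hk : 2 ≤ k)
    (hG : CycleFree G (2 * k + 1)) (hn : 252 * k ≤ n) (hcard : Fintype.card V = n) {X : Finset V}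
    (hcut : n ^ 2 ≤ 4 * ∑ x ∈ X, #{y ∈ Xᶜ | G.Adj x y} + 4 * M) (hM : 120 * M ≤ n ^ 2) :
    ∃ L : Finset V, n * #L ≤ 14 * M ∧
      ∀ S : Set V, (∀ v ∈ S, #L + 3 ≤ G.degree v) → (G.induce S).Colorable 2 := by
  have hXY : #X + #Xᶜ = n := by rw [card_add_card_compl, hcard]
  generalize hY : Xᶜ = Y at hcut hXY
  have hdisj : Disjoint X Y := hY ▸ disjoint_compl_right
  have hle : ∑ x ∈ X, #{y ∈ Y | G.Adj x y} ≤ #X * #Y := by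
    rw [← smul_eq_mul]
    exact sum_le_card_nsmul _ _ _ fun x _ => card_filter_le _ _
  have hprod : #X * #Y ≤ ∑ x ∈ X, #{y ∈ Y | G.Adj x y} + M := by
    nlinarith [sq_nonneg ((#X : ℤ) - #Y), hXY]
  have hprod' : #Y * #X ≤ ∑ y ∈ Y, #{x ∈ X | G.Adj y x} + M := by
    rw [mul_comm, ← sum_card_adj_comm]; exact hprod
  have hnpos : 0 < n := by omega
  have hbig : ∀ a b : ℕ, a + b = n → n ^ 2 ≤ 4 * (a * b) + 4 * M → 4 * n ≤ 10 * a := by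
    intro a b hab h
    by_contra hlt
    push Not at hlt
    subst hab
    nlinarith
  have hXbig := hbig (#X) (#Y) hXY (by omega)
  have hYbig := hbig (#Y) (#X) (by omega) (by rw [mul_comm (#Y)]; omega)
  have hLX := card_mul_le_of_sum_le (n := n) hprod
  have hLY := card_mul_le_of_sum_le (n := n) hprod'
  set LX : Finset V := {x ∈ X | n < 7 * #{y ∈ Y | ¬ G.Adj x y}} with hLXdef
  set LY : Finset V := {x ∈ Y | n < 7 * #{y ∈ X | ¬ G.Adj x y}} with hLYdef
  have hsmall : ∀ a : ℕ, n * a ≤ 7 * M → 120 * a ≤ 7 * n := by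
    intro a ha
    refine Nat.le_of_mul_le_mul_left ?_ hnpos
    nlinarith
  have hLX' := hsmall _ hLX
  have hLY' := hsmall _ hLY
  have hP : ∀ x ∈ X \ LX, 7 * #{y ∈ Y | ¬ G.Adj x y} ≤ n := by
    intro x hx
    rw [mem_sdiff, hLXdef, mem_filter] at hx
    by_contra h
    exact hx.2 ⟨hx.1, not_le.1 h⟩
  have hQ : ∀ x ∈ Y \ LY, 7 * #{y ∈ X | ¬ G.Adj x y} ≤ n := by
    intro x hx
    rw [mem_sdiff, hLYdef, mem_filter] at hx
    by_contra h
    exact hx.2 ⟨hx.1, not_le.1 h⟩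
  have hcompl : #((X \ LX) ∪ (Y \ LY))ᶜ ≤ #(LX ∪ LY) := by
    refine card_le_card fun v => ?_
    have : v ∈ X ∨ v ∈ Y := by rw [← hY, mem_compl]; tauto
    simp only [mem_compl, mem_union, mem_sdiff]
    tauto
  refine ⟨LX ∪ LY, ?_, fun S hS => ?_⟩
  · have := Nat.mul_le_mul_left n (card_union_le LX LY)
    rw [mul_add] at this
    omega
  refine hG.induce_colorable_of_core (P := X \ LX) (Q := Y \ LY) hk
    (hdisj.mono sdiff_subset sdiff_subset) ?_ ?_
    fun v hv => (Nat.add_le_add_right hcompl 3).trans (hS v hv)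
  · intro x hx x' hx'
    have := card_le_common_neighbors (L := LY) (hP x hx) (hP x' hx')
    omega
  · intro x hx x' hx'
    have := card_le_common_neighbors (L := LX) (hQ x hx) (hQ x' hx')
    omega

/-- A set in which every vertex has at least `d` neighbours contains paths on up to `d + 1`
vertices. -/
theorem exists_path_of_min_degree {V : Type*} [DecidableEq V] {G : SimpleGraph V}
    [DecidableRel G.Adj] {W : Finset V} {d : ℕ} (hW : W.Nonempty)
    (hd : ∀ w ∈ W, d ≤ #{x ∈ W | G.Adj w x}) (i : ℕ) :
    i ≤ d → ∃ l : List V, l.length = i + 1 ∧ l.Nodup ∧ (∀ a ∈ l, a ∈ W) ∧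
      List.IsChain G.Adj l := by
  induction i with
  | zero =>
    obtain ⟨w, hw⟩ := hW
    exact fun _ => ⟨[w], by simp [hw]⟩
  | succ i ih =>
    intro hi
    obtain ⟨l, hl, hnd, hlW, hc⟩ := ih (by omega)
    obtain _ | ⟨a, l⟩ := l
    · simp at hl
    have hl' : l.length = i := by simpa using hl
    have h1 := List.toFinset_card_le l
    obtain ⟨b, hb, hbl⟩ := exists_mem_notMem_of_card_lt_card
      (lt_of_lt_of_le (by omega : #l.toFinset < d) (hd a (hlW a (by simp))))
    rw [mem_filter] at hb
    rw [List.mem_toFinset] at hbl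
    refine ⟨b :: a :: l, by simp [hl'], ?_, ?_, ?_⟩
    · rw [List.nodup_cons]
      refine ⟨?_, hnd⟩
      simp only [List.mem_cons, not_or]
      exact ⟨hb.2.ne', hbl⟩
    · intro c hc
      rcases List.mem_cons.1 hc with rfl | hc
      · exact hb.1
      · exact hlW c hc
    · rw [List.isChain_cons_cons]
      exact ⟨hb.2.symm, hc⟩

/-- Neighbourhoods in a `C_{2k+1}`-free graph are sparse. -/
theorem CycleFree.sum_card_adj_le {V : Type*} [DecidableEq V] {G : SimpleGraph V}
    [DecidableRel G.Adj] {k : ℕ} (hk : 1 ≤ k) (hG : CycleFree G (2 * k + 1)) {v : V}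
    (W : Finset V) : (∀ w ∈ W, G.Adj v w) →
      ∑ w ∈ W, #{x ∈ W | G.Adj w x} ≤ 4 * (k - 1) * #W := by
  induction hm : #W generalizing W with
  | zero => simp [card_eq_zero.1 hm]
  | succ m ih =>
    intro hvW
    have hne : W.Nonempty := card_pos.1 (by omega)
    obtain ⟨w, hw, hwd⟩ : ∃ w ∈ W, #{x ∈ W | G.Adj w x} ≤ 2 * (k - 1) := by
      by_contra! h
      obtain ⟨l, hl, hnd, hlW, hc⟩ := exists_path_of_min_degree hne
        (fun w hw => (h w hw : 2 * (k - 1) + 1 ≤ _)) (2 * (k - 1) + 1) le_rfl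
      refine hG.not_isChain (a := v) (l := l) (by omega) ?_ ?_
      · rw [List.nodup_cons]
        exact ⟨fun hv => (hvW v (hlW v hv)).ne rfl, hnd⟩
      · rw [List.isChain_cons, List.isChain_append]
        refine ⟨?_, hc, by simp, ?_⟩
        · obtain _ | ⟨a, l⟩ := l
          · simp at hl
          · simpa using hvW a (hlW a (by simp))
        · intro x hx y hy
          obtain rfl : v = y := by simpa using hy
          exact (hvW x (hlW x (List.mem_of_getLast? hx))).symm
    have hm' : #(W.erase w) = m := by rw [card_erase_of_mem hw]; omega
    have h1 := ih (W.erase w) hm' fun x hx => hvW x (mem_of_mem_erase hx)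
    have h2 : ∀ y, #{x ∈ W | G.Adj y x} =
        #{x ∈ W.erase w | G.Adj y x} + if G.Adj y w then 1 else 0 := by
      intro y
      simp only [card_filter]
      rw [sum_erase_add _ _ hw]
    have h3 : ∑ y ∈ W.erase w, #{x ∈ W | G.Adj y x} =
        ∑ y ∈ W.erase w, #{x ∈ W.erase w | G.Adj y x} + #{x ∈ W.erase w | G.Adj w x} := by
      rw [sum_congr rfl fun y _ => h2 y, sum_add_distrib, card_filter]
      simp only [G.adj_comm w]
    have h4 := h2 w
    rw [if_neg (G.irrefl)] at h4
    rw [← sum_erase_add _ _ hw, h3]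
    have : 4 * (k - 1) * (m + 1) = 4 * (k - 1) * m + 4 * (k - 1) := by ring
    omega

theorem degree_eq_card_add_card {V : Type*} [Fintype V] [DecidableEq V] (G : SimpleGraph V)
    [DecidableRel G.Adj] (X : Finset V) (v : V) :
    G.degree v = #{x ∈ X | G.Adj v x} + #{x ∈ Xᶜ | G.Adj v x} := by
  rw [← G.card_neighborFinset_eq_degree, G.neighborFinset_eq_filter]
  simp only [card_filter]
  rw [sum_add_sum_compl]

/-- The neighbourhood of a vertex of maximum degree is one side of a large cut. -/
theorem CycleFree.exists_cut {V : Type*} [Fintype V] [DecidableEq V] [Nonempty V]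
    {G : SimpleGraph V} [DecidableRel G.Adj] {k n : ℕ} (hk : 1 ≤ k)
    (hG : CycleFree G (2 * k + 1)) (hcard : Fintype.card V = n) :
    ∃ X : Finset V, 8 * #G.edgeFinset ≤
      4 * ∑ x ∈ X, #{y ∈ Xᶜ | G.Adj x y} + (n + 4 * (k - 1)) ^ 2 := by
  obtain ⟨v, hv⟩ := G.exists_maximal_degree_vertex
  refine ⟨G.neighborFinset v, ?_⟩
  have hsum := G.sum_degrees_eq_twice_card_edges
  have hX : #(G.neighborFinset v) = G.degree v := G.card_neighborFinset_eq_degree v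
  have h1 := hG.sum_card_adj_le hk (v := v) (G.neighborFinset v) (by simp)
  generalize G.neighborFinset v = X at *
  rw [← sum_add_sum_compl X] at hsum
  have h2 : ∑ x ∈ X, G.degree x =
      ∑ x ∈ X, #{y ∈ X | G.Adj x y} + ∑ x ∈ X, #{y ∈ Xᶜ | G.Adj x y} := by
    rw [← sum_add_distrib]
    exact sum_congr rfl fun x _ => degree_eq_card_add_card G X x
  have h3 : ∑ x ∈ Xᶜ, G.degree x ≤ #Xᶜ * #X := by
    rw [← smul_eq_mul, hX, ← hv]
    exact sum_le_card_nsmul _ _ _ fun x _ => G.degree_le_maxDegree x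
  have h4 : #X + #Xᶜ = n := by rw [card_add_card_compl, hcard]
  zify at *
  nlinarith [sq_nonneg ((#Xᶜ : ℤ) + 4 * ((k - 1 : ℕ) : ℤ) - #X)]

/-- A graph that becomes bipartite on `S` has a cut inside `S` containing all edges within `S`. -/
theorem exists_cut_of_induce_colorable {V : Type*} [Fintype V] [DecidableEq V] {G : SimpleGraph V}
    [DecidableRel G.Adj] {S : Finset V} (h : (G.induce (S : Set V)).Colorable 2) :
    ∃ X ⊆ S, #G.edgeFinset ≤
      ∑ x ∈ X, #{y ∈ S \ X | G.Adj x y} + ∑ v ∈ Sᶜ, G.degree v := by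
  obtain ⟨c⟩ := h
  let X : Finset V := {v ∈ S | ∃ hv : v ∈ (S : Set V), c ⟨v, hv⟩ = 0}
  have hXS : X ⊆ S := filter_subset _ _
  refine ⟨X, hXS, ?_⟩
  have hin : ∀ u ∈ X, ∀ w ∈ X, ¬ G.Adj u w := by
    intro u hu w hw huw
    obtain ⟨-, hu', hu0⟩ := mem_filter.1 hu
    obtain ⟨-, hw', hw0⟩ := mem_filter.1 hw
    exact c.valid (show (G.induce (S : Set V)).Adj ⟨u, hu'⟩ ⟨w, hw'⟩ from huw) (hu0.trans hw0.symm)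
  have hout : ∀ u ∈ S \ X, ∀ w ∈ S \ X, ¬ G.Adj u w := by
    intro u hu w hw huw
    rw [mem_sdiff] at hu hw
    have hu0 : c ⟨u, mem_coe.2 hu.1⟩ ≠ 0 := fun h0 => hu.2 (mem_filter.2 ⟨hu.1, hu.1, h0⟩)
    have hw0 : c ⟨w, mem_coe.2 hw.1⟩ ≠ 0 := fun h0 => hw.2 (mem_filter.2 ⟨hw.1, hw.1, h0⟩)
    have := c.valid (show (G.induce (S : Set V)).Adj ⟨u, hu.1⟩ ⟨w, hw.1⟩ from huw)
    omega
  have hsplit : ∀ u, #{y ∈ S | G.Adj u y} = #{y ∈ S \ X | G.Adj u y} + #{y ∈ X | G.Adj u y} := by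
    intro u
    simp only [card_filter]
    rw [sum_sdiff hXS]
  have h1 : ∑ u ∈ X, #{y ∈ S | G.Adj u y} = ∑ u ∈ X, #{y ∈ S \ X | G.Adj u y} := by
    refine sum_congr rfl fun u hu => ?_
    rw [hsplit, Nat.add_eq_left, card_eq_zero, filter_eq_empty_iff]
    exact fun w hw => hin u hu w hw
  have h2 : ∑ u ∈ S \ X, #{y ∈ S | G.Adj u y} = ∑ u ∈ X, #{y ∈ S \ X | G.Adj u y} := by
    rw [sum_card_adj_comm X]
    refine sum_congr rfl fun u hu => ?_
    rw [hsplit, Nat.add_eq_right, card_eq_zero, filter_eq_empty_iff]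
    exact fun w hw => hout u hu w hw
  have h3 := sum_sdiff (f := fun u => #{y ∈ S | G.Adj u y}) hXS
  have hsum := G.sum_degrees_eq_twice_card_edges
  rw [← sum_add_sum_compl S] at hsum
  have h4 : ∑ x ∈ S, G.degree x =
      ∑ x ∈ S, #{y ∈ S | G.Adj x y} + ∑ x ∈ Sᶜ, #{y ∈ S | G.Adj x y} := by
    rw [← sum_card_adj_comm S Sᶜ, ← sum_add_distrib]
    exact sum_congr rfl fun x _ => degree_eq_card_add_card G S x
  have h5 : ∑ x ∈ Sᶜ, #{y ∈ S | G.Adj x y} ≤ ∑ x ∈ Sᶜ, G.degree x :=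
    sum_le_sum fun x _ => (degree_eq_card_add_card G S x).symm ▸ Nat.le_add_right _ _
  omega

/-- Edge bound for a graph that is bipartite outside a set `T`. -/
theorem edges_le_of_induce_colorable {V : Type*} [Fintype V] [DecidableEq V] {G : SimpleGraph V}
    [DecidableRel G.Adj] {T : Finset V} (h : (G.induce (Tᶜ : Set V)).Colorable 2) :
    ∃ X : Finset V, #G.edgeFinset ≤ ∑ x ∈ X, #{y ∈ Xᶜ | G.Adj x y} + ∑ v ∈ T, G.degree v ∧
      4 * #G.edgeFinset ≤ (Fintype.card V - #T) ^ 2 + 4 * ∑ v ∈ T, G.degree v := by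
  rw [← coe_compl] at h
  obtain ⟨X, hXS, hX⟩ := exists_cut_of_induce_colorable h
  rw [compl_compl] at hX
  refine ⟨X, hX.trans (Nat.add_le_add_right (sum_le_sum fun x _ => card_le_card
    (filter_subset_filter _ fun y hy => mem_compl.2 (mem_sdiff.1 hy).2)) _), ?_⟩
  have h1 : ∑ x ∈ X, #{y ∈ Tᶜ \ X | G.Adj x y} ≤ #X * #(Tᶜ \ X) := by
    rw [← smul_eq_mul]
    exact sum_le_card_nsmul _ _ _ fun x _ => card_filter_le _ _
  have h2 := card_sdiff_add_card_eq_card hXS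
  rw [card_compl] at h2
  rw [← h2]
  nlinarith [sq_nonneg ((#X : ℤ) - #(Tᶜ \ X))]

/-- In a `C_{2k+1}`-free graph with almost `n² / 4` edges, the vertices of large degree induce a
bipartite graph, and the other vertices are few. -/
theorem CycleFree.exists_large_cut_s12 {V : Type*} [Fintype V] [DecidableEq V] {G : SimpleGraph V}
    [DecidableRel G.Adj] {k n t : ℕ} (hk : 2 ≤ k) (ht : 1 ≤ t) (hn : 252 * t ^ 2 * k ≤ n)
    (hcard : Fintype.card V = n) (hG : CycleFree G (2 * k + 1))
    (he : n ^ 2 ≤ 4 * #G.edgeFinset + 2 * (t + 1) * n) :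
    ∃ X : Finset V, n ^ 2 ≤ 4 * ∑ x ∈ X, #{y ∈ Xᶜ | G.Adj x y} + 4 * (2 * t * n) := by
  have hk252 : 252 * k ≤ n := le_trans (by nlinarith [Nat.one_le_pow 2 t ht]) hn
  have : Nonempty V := Fintype.card_pos_iff.1 (by omega)
  obtain ⟨X, hX⟩ := hG.exists_cut (by omega) hcard
  obtain ⟨j, rfl⟩ : ∃ j, k = j + 1 := ⟨k - 1, by omega⟩
  rw [Nat.add_sub_cancel] at hX
  have hM : 120 * ((t + 1) * n + 2 * j * n + 4 * j ^ 2) ≤ n ^ 2 := by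
    have h1 : t + 1 + 2 * j ≤ 2 * (t ^ 2 * (j + 1)) := by
      nlinarith [Nat.one_le_pow 2 t ht, Nat.mul_le_mul_right j (Nat.one_le_pow 2 t ht)]
    have h2 : j ≤ t ^ 2 * (j + 1) := by nlinarith [Nat.one_le_pow 2 t ht]
    rw [mul_assoc] at hn
    generalize t ^ 2 * (j + 1) = s at *
    have h3 := Nat.mul_le_mul_right n h1
    have h4 := Nat.pow_le_pow_left h2 2
    nlinarith
  obtain ⟨L, hL, hcol⟩ := hG.exists_colorable_of_cut (M := (t + 1) * n + 2 * j * n + 4 * j ^ 2)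
    hk hk252 hcard (X := X) (by nlinarith) hM
  obtain ⟨Y, hY1, hY2⟩ := edges_le_of_induce_colorable (T := {v | G.degree v < #L + 3})
    (hcol _ fun v hv => by simpa using hv)
  refine ⟨Y, ?_⟩
  have hsum : ∑ v with G.degree v < #L + 3, G.degree v ≤
      #{v | G.degree v < #L + 3} * (#L + 2) := by
    rw [← smul_eq_mul]
    exact sum_le_card_nsmul _ _ _ fun v hv => Nat.le_of_lt_succ (mem_filter.1 hv).2
  have hb : #{v | G.degree v < #L + 3} ≤ n := hcard ▸ card_le_univ _
  rw [hcard] at hY2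
  generalize #{v | G.degree v < #L + 3} = b at *
  generalize ∑ v with G.degree v < #L + 3, G.degree v = σ at *
  have hl : 60 * #L ≤ 7 * n := by
    refine Nat.le_of_mul_le_mul_left (c := n) ?_ (by omega)
    nlinarith
  generalize #L = l at *
  have hb8 : b ≤ 8 * t := by
    obtain ⟨c, rfl⟩ := Nat.exists_eq_add_of_le hb
    rw [Nat.add_sub_cancel_left] at hY2
    have h1 : b * (60 * (l + 2)) ≤ b * (7 * (b + c) + 120) := Nat.mul_le_mul_left _ (by omega)
    have h2 : b * 504 ≤ b * (b + c) := Nat.mul_le_mul_left _ (by omega)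
    have h3 : 1 * (b + c) ≤ t * (b + c) := Nat.mul_le_mul_right _ ht
    have h4 : (b + c) ^ 2 = c ^ 2 + b * (b + c) + b * c := by ring
    refine Nat.le_of_mul_le_mul_left (c := b + c) ?_ (by omega)
    linarith [Nat.zero_le (b * c)]
  have h1 : b * (l + 2) ≤ 8 * t * (l + 2) := Nat.mul_le_mul_right _ hb8
  have h2 : t * (8 * (l + 2)) ≤ t * n := Nat.mul_le_mul_left _ (by omega)
  have h3 : 1 * n ≤ t * n := Nat.mul_le_mul_right _ ht
  linarith

theorem card_le_of_sq_le {b t n : ℕ} {s : ℝ} (ht : 1 ≤ t) (hs : s ^ 2 = t * n)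
    (hn1 : 504 * t ^ 2 ≤ n) (hn2 : 126 * t ^ 2 * (t + 2) ≤ n) (hb : b ≤ n)
    (h : ((n : ℝ) - t - 1) ^ 2 + 2 * (t + 2) * (t + 1) ≤ (n - b) ^ 2 + 8 * b * s + 3) :
    b ≤ t + 1 := by
  by_contra! hlt
  have hlt' : (t : ℝ) + 2 ≤ b := by exact_mod_cast hlt
  have ht' : (1 : ℝ) ≤ t := by exact_mod_cast ht
  have hb' : (b : ℝ) ≤ n := by exact_mod_cast hb
  have hn1' : 504 * (t : ℝ) ^ 2 ≤ n := by exact_mod_cast hn1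
  have hn2' : 126 * (t : ℝ) ^ 2 * (t + 2) ≤ n := by exact_mod_cast hn2
  have hn504 : 504 * (t : ℝ) ≤ n := by nlinarith
  have h1 : 22 * s ≤ n := by
    refine abs_le_of_sq_le_sq' ?_ (by linarith) |>.2
    nlinarith
  have h2 : 4 * (s * (t + 2)) < n := by
    refine abs_lt_of_sq_lt_sq' ?_ (by linarith) |>.2
    have h3 : 16 * (t * ((t : ℝ) + 2) ^ 2) < n := by nlinarith
    calc (4 * (s * ((t : ℝ) + 2))) ^ 2 = 16 * (t * ((t : ℝ) + 2) ^ 2) * n := by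
          rw [show (4 * (s * (t + 2))) ^ 2 = 16 * (s ^ 2 * ((t : ℝ) + 2) ^ 2) by ring, hs]; ring
      _ < (n : ℝ) * n := mul_lt_mul_of_pos_right h3 (by linarith)
      _ = (n : ℝ) ^ 2 := by ring
  have h4 : 0 ≤ ((b : ℝ) - t - 2) * (2 * n - 8 * s - b - t - 2) :=
    mul_nonneg (by linarith) (by linarith)
  nlinarith

end

/-- Lemma: for a `C_{2k+1}`-free graph `G` on `n ≥ 252t²k` vertices with
`e(G) ≥ ⌊(n-t-1)²/4⌋ + C(t+2,2)`, where `B` is the set of vertices of degree less than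
`2√(tn)`, the graph `G - B` is bipartite and `|B| ≤ t + 1`. -/
theorem stmt12 {V : Type*} [Fintype V] (G : SimpleGraph V) [DecidableRel G.Adj]
    (k n t : ℕ) (hk : 2 ≤ k) (ht1 : 1 ≤ t) (ht2 : t ≤ 2 * k - 2)
    (hn : 252 * t ^ 2 * k ≤ n)
    (hcard : Fintype.card V = n)
    (hfree : CycleFree G (2 * k + 1))
    (hedge : (n - t - 1) ^ 2 / 4 + (t + 2).choose 2 ≤ G.edgeFinset.card)
    (B : Set V) (hB : B = {v : V | (G.degree v : ℝ) < 2 * Real.sqrt (t * n)}) :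
    (G.induce Bᶜ).Colorable 2 ∧ B.ncard ≤ t + 1 := by
  classical
  have ht : 252 * k ≤ 252 * t ^ 2 * k := by nlinarith [Nat.one_le_pow 2 t ht1]
  have ht504 : 504 * t ^ 2 ≤ n := le_trans (by nlinarith) hn
  have ht126 : 126 * t ^ 2 * (t + 2) ≤ n := by
    refine le_trans ?_ hn
    have := Nat.mul_le_mul_left (126 * t ^ 2) (by omega : t + 2 ≤ 2 * k)
    linarith
  have hC : 2 * (t + 2).choose 2 = (t + 2) * (t + 1) := by
    rw [Nat.choose_two_right]
    exact Nat.mul_div_cancel' (by simpa using (Nat.even_mul_pred_self (t + 2)).two_dvd)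
  obtain ⟨a, rfl⟩ : ∃ a, n = a + t + 1 := ⟨n - t - 1, by
    have : t + 1 ≤ n := by nlinarith
    omega⟩
  rw [show a + t + 1 - t - 1 = a by omega] at hedge
  have he : a ^ 2 + 2 * ((t + 2) * (t + 1)) ≤ 4 * G.edgeFinset.card + 3 := by omega
  generalize hn' : a + t + 1 = n at *
  have hcol : (G.induce Bᶜ).Colorable 2 := by
    obtain ⟨X, hX⟩ := hfree.exists_large_cut_s12 hk ht1 hn hcard (by subst hn'; nlinarith)
    obtain ⟨L, hL, hcol⟩ := hfree.exists_colorable_of_cut hk (ht.trans hn) hcard hX (by nlinarith)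
    refine hcol _ fun v hv => ?_
    rw [hB, Set.mem_compl_iff, Set.mem_ofPred_eq, not_lt] at hv
    have h1 : 4 * (t * n) ≤ G.degree v ^ 2 := by
      have h2 := pow_le_pow_left₀ (by positivity) hv 2
      rw [mul_pow, Real.sq_sqrt (by positivity)] at h2
      norm_num at h2
      exact_mod_cast h2
    have h3 : L.card ≤ 28 * t :=
      Nat.le_of_mul_le_mul_left (c := n) (by linarith) (by omega)
    have h4 : 31 * t ≤ G.degree v := by
      refine (Nat.pow_le_pow_iff_left two_ne_zero).1 (le_trans ?_ h1)
      nlinarith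
    omega
  refine ⟨hcol, ?_⟩
  obtain ⟨T, rfl⟩ : ∃ T : Finset V, B = T := ⟨B.toFinset, by simp⟩
  obtain ⟨-, -, hT⟩ := edges_le_of_induce_colorable hcol
  rw [Set.ncard_coe_finset]
  have hTn : T.card ≤ n := hcard ▸ T.card_le_univ
  have hsum : ((∑ v ∈ T, G.degree v : ℕ) : ℝ) ≤ T.card * (2 * Real.sqrt (t * n)) := by
    rw [← nsmul_eq_mul, Nat.cast_sum]
    refine Finset.sum_le_card_nsmul _ _ _ fun v hv => ?_
    rw [← Finset.mem_coe, hB] at hv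
    exact le_of_lt hv
  refine card_le_of_sq_le ht1 (Real.sq_sqrt (by positivity)) ht504 ht126 hTn ?_
  rw [hcard] at hT
  have hT' : (4 * G.edgeFinset.card : ℝ) ≤
      ((n : ℝ) - T.card) ^ 2 + 4 * (∑ v ∈ T, G.degree v : ℕ) := by
    rw [← Nat.cast_sub hTn]
    exact_mod_cast hT
  have he' : (a : ℝ) ^ 2 + 2 * ((t + 2) * (t + 1)) ≤ 4 * G.edgeFinset.card + 3 := by
    exact_mod_cast he
  have ha : (n : ℝ) - t - 1 = a := by rw [← hn']; push_cast; ring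
  rw [ha]
  linarith
end
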